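/- (Tits alternative for linear groups) Let k be a field of characteristic zero, let n be a positive integer, and let Γ be a finitely generated subgroup of GL_n(k). Then at least one of the following holds: (i) Γ contains a nonabelian free subgroup, i.e. a subgroup isomorphic to the free group on two generators; (ii) Γ contains a solvable subgroup of finite index. -/

import Mathlib

theorem exists_connected {G K : Type*} [Group G] [Field K] (A : Subalgebra K (G → K))
    [IsNoetherianRing A] (htr : ∀ h : G, ∀ f ∈ A, (fun x => f (h * x)) ∈ A) :
    ∃ H : Subgroup G, H.FiniteIndex ∧ ∀ f₁ ∈ A, ∀ f₂ ∈ A, (∀ x ∈ H, f₁ x * f₂ x = 0) →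
      (∀ x ∈ H, f₁ x = 0) ∨ (∀ x ∈ H, f₂ x = 0) := by
  classical
  let I : Subgroup G → Ideal A := fun H =>
    { carrier := {f | ∀ x ∈ H, f.1 x = 0}
      add_mem' := by
        intro a b ha hb x hx
        simp [ha x hx, hb x hx]
      zero_mem' := by intro x hx; rfl
      smul_mem' := by
        intro c a ha x hx
        simp [ha x hx] }
  have hImem : ∀ H (f : A), f ∈ I H ↔ ∀ x ∈ H, f.1 x = 0 := fun H f => Iff.rfl
  obtain ⟨_, ⟨H, hH, rfl⟩, hmax⟩ := WellFounded.has_min (r := ((· > ·) : Ideal A → Ideal A → Prop))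
    (IsWellFounded.wf) {J | ∃ H : Subgroup G, H.FiniteIndex ∧ J = I H} ⟨_, ⊤, inferInstance, rfl⟩
  have hanti : ∀ H' : Subgroup G, H' ≤ H → I H ≤ I H' := fun H' h f hf x hx => hf x (h hx)
  have hstab : ∀ H' : Subgroup G, H' ≤ H → H'.FiniteIndex → I H' ≤ I H := by
    intro H' h hf
    by_contra hcon
    exact hmax _ ⟨H', hf, rfl⟩ (lt_of_le_not_ge (hanti H' h) hcon)
  let τ : G → A →+* A := fun h =>
    { toFun := fun f => ⟨fun x => f.1 (h * x), htr h f.1 f.2⟩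
      map_one' := rfl
      map_mul' := fun _ _ => rfl
      map_zero' := rfl
      map_add' := fun _ _ => rfl }
  have hτ : ∀ h (f : A) x, (τ h f).1 x = f.1 (h * x) := fun _ _ _ => rfl
  have hτmul : ∀ h k, τ (h * k) = (τ k).comp (τ h) := by
    intro h k
    ext f x
    simp [hτ, mul_assoc]
  have hτone : τ 1 = RingHom.id _ := by
    ext f x
    simp [hτ]
  letI act : MulAction G (Ideal A) :=
    { smul := fun h p => Ideal.comap (τ h) p
      one_smul := by
        intro p
        change Ideal.comap (τ 1) p = p
        rw [hτone, Ideal.comap_id]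
      mul_smul := by
        intro h k p
        change Ideal.comap (τ (h * k)) p = Ideal.comap (τ h) (Ideal.comap (τ k) p)
        rw [Ideal.comap_comap, hτmul] }
  have hsm : ∀ (h : G) (p : Ideal A), h • p = Ideal.comap (τ h) p := fun _ _ => rfl
  have hsmle : ∀ (h : G) (p q : Ideal A), p ≤ q → h • p ≤ h • q := fun h p q hpq =>
    Ideal.comap_mono hpq
  have hIinv : ∀ h ∈ H, I H ≤ h • I H := by
    intro h hh f hf x hx
    exact hf _ (H.mul_mem hh hx)
  -- point ideal
  let m₁ : Ideal A := RingHom.ker (((Pi.evalRingHom (fun _ : G => K) 1)).comp A.val.toRingHom)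
  haveI : m₁.IsPrime := RingHom.ker_isPrime _
  have hm₁ : ∀ f : A, f ∈ m₁ ↔ f.1 1 = 0 := fun f => Iff.rfl
  have hIm : I H ≤ m₁ := fun f hf => hf 1 H.one_mem
  obtain ⟨p, hp, hpm⟩ := Ideal.exists_minimalPrimes_le hIm
  have hfin : ((I H).minimalPrimes).Finite := Ideal.finite_minimalPrimes_of_isNoetherianRing _ _
  have hmin : ∀ h ∈ H, h • p ∈ (I H).minimalPrimes := by
    intro h hh
    haveI := hp.1.1
    refine ⟨⟨Ideal.comap_isPrime _ _, (hIinv h hh).trans (hsmle _ _ _ hp.1.2)⟩, ?_⟩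
    rintro q ⟨hq1, hq2⟩ hqp
    have h1 : h⁻¹ • q ≤ p := by
      have := hsmle h⁻¹ _ _ hqp
      rwa [inv_smul_smul] at this
    have h2 : p ≤ h⁻¹ • q := hp.2
      ⟨Ideal.comap_isPrime _ _, (hIinv _ (H.inv_mem hh)).trans (hsmle _ _ _ hq2)⟩ h1
    have := hsmle h _ _ h2
    rwa [smul_inv_smul] at this
  have hfi : (H ⊓ MulAction.stabilizer G p).FiniteIndex := by
    have h1 : (MulAction.stabilizer H p).index ≠ 0 := by
      rw [MulAction.index_stabilizer]
      have : (MulAction.orbit H p).Finite := by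
        refine hfin.subset ?_
        rintro _ ⟨h, rfl⟩
        exact hmin h.1 h.2
      exact (Set.ncard_pos this).2 ⟨p, MulAction.mem_orbit_self p⟩ |>.ne'
    have h2 : (MulAction.stabilizer G p).relIndex H ≠ 0 := h1
    constructor
    rw [← Subgroup.relIndex_mul_index (inf_le_left : H ⊓ MulAction.stabilizer G p ≤ H),
      Subgroup.inf_relIndex_left]
    exact mul_ne_zero h2 hH.index_ne_zero
  have hple : p ≤ I (H ⊓ MulAction.stabilizer G p) := by
    intro f hf x hx
    have hx2 : x • p = p := hx.2
    rw [← hx2] at hf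
    have := hpm hf
    rw [hm₁, hτ, mul_one] at this
    exact this
  have heq : I H = p := le_antisymm hp.1.2 (hple.trans (hstab _ inf_le_left hfi))
  refine ⟨H, hH, fun f₁ h₁ f₂ h₂ h => ?_⟩
  have := hp.1.1
  rw [← heq] at this
  exact this.mem_or_mem (x := ⟨f₁, h₁⟩) (y := ⟨f₂, h₂⟩) h

theorem nilp_of_trace {k : Type*} [Field k] [CharZero k] {n : ℕ} (x : Matrix (Fin n) (Fin n) k)
    (h : ∀ q : Polynomial k, (Polynomial.aeval x (q * Polynomial.X)).trace = 0) :
    IsNilpotent x := by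
  classical
  obtain ⟨q, hq, hq2⟩ := Polynomial.exists_eq_pow_rootMultiplicity_mul_and_not_dvd x.charpoly
    x.charpoly_monic.ne_zero 0
  set a := Polynomial.rootMultiplicity 0 x.charpoly
  rw [Polynomial.C_0, sub_zero] at hq hq2
  have hcop : IsCoprime (Polynomial.X ^ (a + 1)) q :=
    ((Polynomial.irreducible_X.coprime_iff_not_dvd).2 hq2).pow_left
  obtain ⟨u, v, huv⟩ := hcop
  have hch : Polynomial.aeval x (Polynomial.X ^ a * q) = 0 := by
    rw [← hq]; exact Matrix.aeval_self_charpoly x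
  set e := Polynomial.aeval x (u * Polynomial.X ^ (a + 1)) with he
  have h1e : 1 - e = Polynomial.aeval x (v * q) := by
    have := congrArg (Polynomial.aeval x) huv
    rw [map_add, map_one] at this
    rw [← this, he]; abel
  have hidem : e * (1 - e) = 0 := by
    rw [h1e, he, ← map_mul,
      show u * Polynomial.X ^ (a + 1) * (v * q) = u * v * Polynomial.X * (Polynomial.X ^ a * q) by
        ring, map_mul, hch, mul_zero]
  have hidem' : IsIdempotentElem e := by
    rw [mul_sub, mul_one, sub_eq_zero] at hidem
    exact hidem.symm
  have htr : e.trace = 0 := by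
    have := h (u * Polynomial.X ^ a)
    rw [mul_assoc, ← pow_succ] at this
    exact this
  have he0 : e = 0 := by
    have h2 : IsIdempotentElem (Matrix.toLin' e) := by
      unfold IsIdempotentElem
      rw [Module.End.mul_eq_comp, ← Matrix.toLin'_mul, hidem']
    have h3 := LinearMap.IsIdempotentElem.eq_zero_of_trace_eq_zero h2
      (by rw [Matrix.trace_toLin'_eq, htr])
    simpa using h3
  refine ⟨a, ?_⟩
  rw [he0, sub_zero] at h1e
  have h5 : x ^ a = Polynomial.aeval x (Polynomial.X ^ a : Polynomial k) := by
    rw [map_pow, Polynomial.aeval_X]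
  have h6 : x ^ a = Polynomial.aeval x (v * (Polynomial.X ^ a * q)) := by
    rw [show v * (Polynomial.X ^ a * q) = Polynomial.X ^ a * (v * q) by ring, map_mul, ← h1e, ← h5,
      mul_one]
  rw [h6, map_mul, hch, mul_zero]

theorem solv_of_ideal {B D : Type*} [Ring B] [Group D] (ρ : D →* B)
    (hρ : Function.Injective ρ) (I : Ideal B) [I.IsTwoSided] (N : ℕ) (hN : I ^ N = ⊥)
    (h : ∀ x, ρ x - 1 ∈ I) : Group.IsSolvable D := by
  let S : ℕ → Subgroup D := fun m =>
    { carrier := {x | ρ x - 1 ∈ I ^ (m + 1)}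
      mul_mem' := by
        intro a b ha hb
        have : ρ (a * b) - 1 = ρ a * (ρ b - 1) + (ρ a - 1) := by rw [map_mul]; noncomm_ring
        simp only [Set.mem_ofPred_eq] at *
        rw [this]
        exact add_mem (Ideal.mul_mem_left _ _ hb) ha
      one_mem' := by simp
      inv_mem' := by
        intro a ha
        have : ρ (a⁻¹) - 1 = - (ρ a⁻¹ * (ρ a - 1)) := by
          rw [mul_sub, ← map_mul]; simp
        simp only [Set.mem_ofPred_eq] at *
        rw [this]
        exact neg_mem (Ideal.mul_mem_left _ _ ha) }
  have hS : ∀ m x, x ∈ S m ↔ ρ x - 1 ∈ I ^ (m + 1) := fun _ _ => Iff.rfl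
  have hder : ∀ m, derivedSeries D m ≤ S m := by
    intro m
    induction m with
    | zero =>
      intro x _
      rw [hS, zero_add, Submodule.pow_one]; exact h x
    | succ m ih =>
      rw [derivedSeries_succ, Subgroup.commutator_le]
      intro a ha b hb
      have ha := (hS _ _).1 (ih ha)
      have hb := (hS _ _).1 (ih hb)
      rw [hS]
      change ρ (a * b * a⁻¹ * b⁻¹) - 1 ∈ _
      have hab : ρ (a * b * a⁻¹ * b⁻¹) - 1 = ((ρ a - 1) * (ρ b - 1) - (ρ b - 1) * (ρ a - 1)) * ρ (b * a)⁻¹ := by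
        have e1 : (ρ a - 1) * (ρ b - 1) - (ρ b - 1) * (ρ a - 1) = ρ (a * b) - ρ (b * a) := by
          rw [map_mul, map_mul]; noncomm_ring
        rw [e1, sub_mul, ← map_mul, ← map_mul, mul_inv_cancel, map_one,
          mul_inv_rev, mul_assoc (a * b)]
      rw [hab]
      refine Ideal.mul_mem_right _ _ (sub_mem ?_ ?_)
      · rw [Submodule.pow_succ]; exact Ideal.mul_mem_mul ha (h b)
      · rw [Submodule.pow_succ]; exact Ideal.mul_mem_mul hb (h a)
  refine ⟨⟨N, ?_⟩⟩
  rw [eq_bot_iff]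
  intro x hx
  have := (hS _ _).1 (hder N hx)
  rw [Submodule.pow_succ, hN, Submodule.bot_mul, Submodule.mem_bot, sub_eq_zero] at this
  exact hρ (by rw [this, map_one])

theorem kolchin {k D : Type*} [Field k] [CharZero k] [Group D] {n : ℕ}
    (ρ : D →* Matrix (Fin n) (Fin n) k) (hρ : Function.Injective ρ)
    (h : ∀ x, (ρ x).trace = n) : Group.IsSolvable D := by
  classical
  let B : Subalgebra k (Matrix (Fin n) (Fin n) k) := Algebra.adjoin k (Set.range ρ)
  have hB : ∀ x, ρ x ∈ B := fun x => Algebra.subset_adjoin ⟨x, rfl⟩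
  let ρ' : D →* B := ρ.codRestrict B.toSubmonoid hB
  have hρ'v : ∀ x, ((ρ' x : B) : Matrix (Fin n) (Fin n) k) = ρ x := fun x => rfl
  have hρ' : Function.Injective ρ' := fun x y hxy => hρ (congrArg Subtype.val hxy)
  have hspan : ∀ y ∈ B, y ∈ Submodule.span k (Set.range ρ) := by
    intro y hy
    have : Subalgebra.toSubmodule B = Submodule.span k (Submonoid.closure (Set.range ρ)) :=
      Algebra.adjoin_eq_span k _
    have h2 : (Submonoid.closure (Set.range ρ) : Submonoid _) = MonoidHom.mrange ρ := by
      rw [← MonoidHom.coe_mrange, Submonoid.closure_eq]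
    rw [h2, MonoidHom.coe_mrange] at this
    rw [← this]; exact hy
  have : IsArtinianRing B := IsArtinianRing.of_finite k B
  have key : ∀ x : D, ρ' x - 1 ∈ Ideal.jacobson (⊥ : Ideal B) := by
    intro x
    have htr : ∀ y ∈ B, ((ρ x - 1) * y).trace = 0 := by
      intro y hy
      have hy' := hspan y hy
      clear hy
      induction hy' using Submodule.span_induction with
      | mem y hy1 =>
        obtain ⟨z, rfl⟩ := hy1
        rw [sub_mul, one_mul, ← map_mul, Matrix.trace_sub, h, h, sub_self]
      | zero => simp
      | add a b _ _ ha hb => rw [Matrix.mul_add, Matrix.trace_add, ha, hb, add_zero]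
      | smul c a _ ha => rw [Matrix.mul_smul, Matrix.trace_smul, ha, smul_zero]
    rw [Ideal.mem_jacobson_iff]
    intro y
    have hnil : IsNilpotent (y * (ρ' x - 1)) := by
      have : IsNilpotent ((y * (ρ' x - 1) : B) : Matrix (Fin n) (Fin n) k) := by
        apply nilp_of_trace
        intro q
        have hmem : Polynomial.aeval (((y * (ρ' x - 1) : B) : Matrix (Fin n) (Fin n) k)) q ∈ B := by
          have := (Polynomial.aeval (y * (ρ' x - 1)) q).2
          rwa [← Subalgebra.coe_val, ← Polynomial.aeval_algHom_apply] at this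
        rw [map_mul, Polynomial.aeval_X]
        have h2 : ((y * (ρ' x - 1) : B) : Matrix (Fin n) (Fin n) k) = y.1 * (ρ x - 1) := rfl
        rw [h2] at hmem ⊢
        rw [← mul_assoc, Matrix.trace_mul_comm]
        exact htr _ (B.mul_mem hmem y.2)
      obtain ⟨N, hN⟩ := this
      exact ⟨N, Subtype.ext hN⟩
    obtain ⟨u, hu⟩ := hnil.isUnit_one_add
    refine ⟨(u⁻¹ : Bˣ), ?_⟩
    have : ((u⁻¹ : Bˣ) : B) * y * (ρ' x - 1) + ((u⁻¹ : Bˣ) : B) - 1 = 0 := by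
      have h3 := u.inv_mul
      rw [hu] at h3
      rw [mul_add, mul_one, add_comm, ← mul_assoc] at h3
      rw [h3, sub_self]
    rw [this]; exact Submodule.zero_mem _
  obtain ⟨N, hN⟩ := IsArtinianRing.isNilpotent_jacobson_bot (R := B)
  exact solv_of_ideal ρ' hρ' _ N hN key

def regAlg {G K : Type*} [Group G] [Field K] {n : ℕ} (ρ : G →* Matrix (Fin n) (Fin n) K) :
    Subalgebra K (G → K) :=
  Algebra.adjoin K (Set.range (fun (p : Fin n × Fin n) (x : G) => ρ x p.1 p.2) ∪
    Set.range (fun (p : Fin n × Fin n) (x : G) => ρ x⁻¹ p.1 p.2))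

section reg
variable {G K : Type*} [Group G] [Field K] {n : ℕ} (ρ : G →* Matrix (Fin n) (Fin n) K)

theorem regAlg_entry (i j : Fin n) : (fun x => ρ x i j) ∈ regAlg ρ :=
  Algebra.subset_adjoin (Or.inl ⟨(i, j), rfl⟩)

theorem regAlg_entry_inv (i j : Fin n) : (fun x => ρ x⁻¹ i j) ∈ regAlg ρ :=
  Algebra.subset_adjoin (Or.inr ⟨(i, j), rfl⟩)

theorem regAlg_const (c : K) : (fun _ : G => c) ∈ regAlg ρ :=
  (regAlg ρ).algebraMap_mem c

instance regAlg_noeth : IsNoetherianRing (regAlg ρ) := by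
  have : Algebra.FiniteType K (regAlg ρ) := by
    rw [← Subalgebra.fg_iff_finiteType]
    exact Subalgebra.fg_def.2 ⟨_, (Set.finite_range _).union (Set.finite_range _), rfl⟩
  exact Algebra.FiniteType.isNoetherianRing K _

/-- matrix valued functions with regular entries -/
def RegM {m : Type*} (M : G → Matrix m m K) : Prop := ∀ i j, (fun x => M x i j) ∈ regAlg ρ

variable {ρ}

theorem RegM.mul {m : Type*} [Fintype m] {M N : G → Matrix m m K} (hM : RegM ρ M)
    (hN : RegM ρ N) : RegM ρ (fun x => M x * N x) := by
  intro i j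
  have : (fun x => (M x * N x) i j) = ∑ k, (fun x => M x i k) * (fun x => N x k j) := by
    funext x; simp [Matrix.mul_apply]
  rw [this]
  exact sum_mem fun k _ => mul_mem (hM i k) (hN k j)

theorem RegM.add {m : Type*} {M N : G → Matrix m m K} (hM : RegM ρ M)
    (hN : RegM ρ N) : RegM ρ (fun x => M x + N x) :=
  fun i j => add_mem (hM i j) (hN i j)

theorem RegM.const {m : Type*} (M : Matrix m m K) : RegM ρ (fun _ => M) :=
  fun i j => regAlg_const ρ (M i j)

theorem RegM.id : RegM ρ (fun x => ρ x) := fun i j => regAlg_entry ρ i j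
theorem RegM.inv : RegM ρ (fun x => ρ x⁻¹) := fun i j => regAlg_entry_inv ρ i j

theorem RegM.charpoly {m : Type*} [Fintype m] [DecidableEq m] {M : G → Matrix m m K}
    (hM : RegM ρ M) (i : ℕ) : (fun x => (M x).charpoly.coeff i) ∈ regAlg ρ := by
  let N : Matrix m m (regAlg ρ) := fun i j => ⟨fun x => M x i j, hM i j⟩
  have : (fun x => (M x).charpoly.coeff i) = (N.charpoly.coeff i : regAlg ρ).1 := by
    funext x
    let ev : regAlg ρ →+* K := (Pi.evalRingHom (fun _ : G => K) x).comp (regAlg ρ).val.toRingHom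
    have h1 : N.map ev = M x := rfl
    rw [← h1, Matrix.charpoly_map, Polynomial.coeff_map]; rfl
  rw [this]; exact SetLike.coe_mem _

theorem RegM.det {m : Type*} [Fintype m] [DecidableEq m] {M : G → Matrix m m K}
    (hM : RegM ρ M) : (fun x => (M x).det) ∈ regAlg ρ := by
  let N : Matrix m m (regAlg ρ) := fun i j => ⟨fun x => M x i j, hM i j⟩
  have : (fun x => (M x).det) = (N.det : regAlg ρ).1 := by
    funext x
    let ev : regAlg ρ →+* K := (Pi.evalRingHom (fun _ : G => K) x).comp (regAlg ρ).val.toRingHom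
    have h1 : ev.mapMatrix N = M x := rfl
    rw [← h1, ← RingHom.map_det]; rfl
  rw [this]; exact SetLike.coe_mem _

theorem regAlg_comp {G' : Type*} [Group G'] {n' : ℕ} {ρ' : G' →* Matrix (Fin n') (Fin n') K}
    (τ : G' → G) (h1 : RegM ρ' (fun x => ρ (τ x))) (h2 : RegM ρ' (fun x => ρ (τ x)⁻¹))
    {f : G → K} (hf : f ∈ regAlg ρ) : (fun x => f (τ x)) ∈ regAlg ρ' := by
  induction hf using Algebra.adjoin_induction with
  | mem f hf =>
    rcases hf with ⟨p, rfl⟩ | ⟨p, rfl⟩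
    · exact h1 _ _
    · exact h2 _ _
  | algebraMap r => exact regAlg_const ρ' r
  | add a b _ _ ha hb => exact add_mem ha hb
  | mul a b _ _ ha hb => exact mul_mem ha hb

theorem regAlg_two_sided (a b : G) {f : G → K} (hf : f ∈ regAlg ρ) :
    (fun x => f (a * x * b)) ∈ regAlg ρ := by
  refine regAlg_comp (fun x => a * x * b) ?_ ?_ hf
  · have := ((RegM.const (ρ := ρ) (ρ a)).mul RegM.id).mul (RegM.const (ρ b))
    simpa only [← map_mul] using this
  · have := ((RegM.const (ρ := ρ) (ρ b⁻¹)).mul RegM.inv).mul (RegM.const (ρ a⁻¹))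
    simpa only [← map_mul, mul_inv_rev, mul_assoc] using this

theorem regAlg_inv {f : G → K} (hf : f ∈ regAlg ρ) :
    (fun x => f x⁻¹) ∈ regAlg ρ := by
  refine regAlg_comp (fun x => x⁻¹) RegM.inv ?_ hf
  simpa only [inv_inv] using RegM.id (ρ := ρ)

end reg

/-- Zariski connectedness -/
def Conn {G K : Type*} [Group G] [Field K] {n : ℕ} (ρ : G →* Matrix (Fin n) (Fin n) K) : Prop :=
  ∀ f₁ ∈ regAlg ρ, ∀ f₂ ∈ regAlg ρ, (∀ x, f₁ x * f₂ x = 0) → (∀ x, f₁ x = 0) ∨ (∀ x, f₂ x = 0)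

theorem exists_conn {G K : Type*} [Group G] [Field K] {n : ℕ}
    (ρ : G →* Matrix (Fin n) (Fin n) K) : ∃ H : Subgroup G, H.FiniteIndex ∧
      Conn (ρ.comp H.subtype) := by
  obtain ⟨H, hH, h⟩ := exists_connected (regAlg ρ)
    (fun a f hf => by simpa using regAlg_two_sided a 1 hf)
  refine ⟨H, hH, ?_⟩
  have ext : ∀ f ∈ regAlg (ρ.comp H.subtype), ∃ f' ∈ regAlg ρ, ∀ x : H, f' x = f x := by
    intro f hf
    induction hf using Algebra.adjoin_induction with
    | mem f hf =>
      rcases hf with ⟨p, rfl⟩ | ⟨p, rfl⟩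
      · exact ⟨_, regAlg_entry ρ p.1 p.2, fun x => rfl⟩
      · exact ⟨_, regAlg_entry_inv ρ p.1 p.2, fun x => rfl⟩
    | algebraMap r => exact ⟨_, regAlg_const ρ r, fun x => rfl⟩
    | add a b _ _ ha hb =>
      obtain ⟨a', ha, ha'⟩ := ha
      obtain ⟨b', hb, hb'⟩ := hb
      exact ⟨_, add_mem ha hb, fun x => by simp [ha', hb']⟩
    | mul a b _ _ ha hb =>
      obtain ⟨a', ha, ha'⟩ := ha
      obtain ⟨b', hb, hb'⟩ := hb
      exact ⟨_, mul_mem ha hb, fun x => by simp [ha', hb']⟩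
  intro f₁ h₁ f₂ h₂ h0
  obtain ⟨a, ha, ha'⟩ := ext _ h₁
  obtain ⟨b, hb, hb'⟩ := ext _ h₂
  rcases h a ha b hb (fun x hx => by rw [ha' ⟨x, hx⟩, hb' ⟨x, hx⟩, h0]) with h | h
  · exact Or.inl fun x => by rw [← ha']; exact h _ x.2
  · exact Or.inr fun x => by rw [← hb']; exact h _ x.2

theorem Conn.finset {G K ι : Type*} [Group G] [Field K] {n : ℕ} {ρ : G →* Matrix (Fin n) (Fin n) K}
    (hc : Conn ρ) (s : Finset ι) (f : ι → G → K) (hf : ∀ i ∈ s, f i ∈ regAlg ρ)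
    (hne : ∀ i ∈ s, ∃ x, f i x ≠ 0) : ∃ x, ∀ i ∈ s, f i x ≠ 0 := by
  classical
  have : ∃ x, (∏ i ∈ s, f i) x ≠ 0 := by
    induction s using Finset.induction_on with
    | empty => exact ⟨1, by simp⟩
    | insert a s ha ih =>
      by_contra! h0
      have h1 := ih (fun i hi => hf i (Finset.mem_insert_of_mem hi))
        (fun i hi => hne i (Finset.mem_insert_of_mem hi))
      rw [Finset.prod_insert ha] at h0
      rcases hc _ (hf a (Finset.mem_insert_self _ _)) _
        (prod_mem fun i hi => hf i (Finset.mem_insert_of_mem hi)) h0 with h | h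
      · obtain ⟨x, hx⟩ := hne a (Finset.mem_insert_self _ _)
        exact hx (h x)
      · obtain ⟨x, hx⟩ := h1
        exact hx (h x)
  obtain ⟨x, hx⟩ := this
  rw [Finset.prod_apply, Finset.prod_ne_zero_iff] at hx
  exact ⟨x, hx⟩

theorem Conn.const {G K : Type*} [Group G] [Field K] {n : ℕ} {ρ : G →* Matrix (Fin n) (Fin n) K}
    (hc : Conn ρ) (f : G → K) (hf : f ∈ regAlg ρ) (F : Set K) (hF : F.Finite)
    (h : ∀ x, f x ∈ F) (x y : G) : f x = f y := by
  by_contra hxy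
  obtain ⟨z, hz⟩ := hc.finset hF.toFinset (fun v x => f x - v)
    (fun v _ => sub_mem hf (regAlg_const ρ v)) (fun v _ => by
      by_contra! h
      exact hxy ((sub_eq_zero.1 (h x)).trans (sub_eq_zero.1 (h y)).symm))
  exact hz (f z) (hF.mem_toFinset.2 (h z)) (sub_self _)

theorem solv_of_finite {G K : Type*} [Group G] [Field K] [CharZero K] {n : ℕ}
    (ρ : G →* Matrix (Fin n) (Fin n) K) (hρ : Function.Injective ρ)
    (hc : Conn ρ) (F : Set K) (hF : F.Finite)
    (h : ∀ x ∈ commutator G, ∀ i, (ρ x).charpoly.coeff i ∈ F) : Group.IsSolvable G := by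
  have key : ∀ x ∈ commutator G, (ρ x).charpoly = (1 : Matrix (Fin n) (Fin n) K).charpoly := by
    intro x hx
    rw [commutator_eq_closure] at hx
    induction hx using Subgroup.closure_induction_left with
    | one => rw [map_one]
    | mul_left c hcm y hy ih =>
      obtain ⟨a, b, rfl⟩ := hcm
      rw [← commutator_eq_closure] at hy
      rw [← ih]
      ext i
      have hreg : (fun z => (ρ (z * b * z⁻¹ * b⁻¹ * y)).charpoly.coeff i) ∈ regAlg ρ := by
        apply RegM.charpoly
        have := (((RegM.id (ρ := ρ)).mul (RegM.const (ρ b))).mul (RegM.inv)).mul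
          (RegM.const (ρ (b⁻¹ * y)))
        simpa only [← map_mul, mul_assoc] using this
      have := hc.const _ hreg F hF (fun z => h _ (mul_mem (Subgroup.commutator_mem_commutator
        (Subgroup.mem_top z) (Subgroup.mem_top b)) hy) i) a 1
      simpa [commutatorElement_def] using this
    | inv_mul_cancel c hcm y hy ih =>
      obtain ⟨a, b, rfl⟩ := hcm
      rw [← commutator_eq_closure] at hy
      rw [← ih]
      ext i
      have hreg : (fun z => (ρ (b * z * b⁻¹ * z⁻¹ * y)).charpoly.coeff i) ∈ regAlg ρ := by
        apply RegM.charpoly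
        have := (((RegM.const (ρ := ρ) (ρ b)).mul RegM.id).mul (RegM.const (ρ b⁻¹))).mul
          (RegM.inv.mul (RegM.const (ρ y)))
        simpa only [← map_mul, mul_assoc] using this
      have := hc.const _ hreg F hF (fun z => h _ (mul_mem (Subgroup.commutator_mem_commutator
        (Subgroup.mem_top b) (Subgroup.mem_top z)) hy) i) a 1
      simpa [commutatorElement_inv, commutatorElement_def, mul_assoc] using this
  have hsol : Group.IsSolvable (commutator G) := by
    refine kolchin (ρ.comp (commutator G).subtype) (hρ.comp Subtype.val_injective) ?_
    intro x
    rcases Nat.eq_zero_or_pos n with rfl | hn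
    · simp [Matrix.trace]
    · have : Nonempty (Fin n) := ⟨⟨0, hn⟩⟩
      rw [Matrix.trace_eq_neg_charpoly_coeff, MonoidHom.comp_apply, Subgroup.coe_subtype,
        key _ x.2, ← Matrix.trace_eq_neg_charpoly_coeff]
      simp
  have : Group.IsSolvable (G ⧸ commutator G) :=
    Group.isSolvable_of_comm (G := Abelianization G) (fun a b => mul_comm a b)
  exact (Group.isSolvable_iff_subgroup_quotient (commutator G)).2 ⟨hsol, this⟩

open Matrix

theorem regAlg_translates {G K : Type*} [Group G] [Field K] {n : ℕ}
    {ρ : G →* Matrix (Fin n) (Fin n) K} {f : G → K} (hf : f ∈ regAlg ρ) :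
    ∃ W : Submodule K (G → K), W.FG ∧ ∀ y, (fun x => f (x * y)) ∈ W := by
  induction hf using Algebra.adjoin_induction with
  | mem f hf =>
    rcases hf with ⟨p, rfl⟩ | ⟨p, rfl⟩
    · refine ⟨Submodule.span K (Set.range fun k => fun x => ρ x p.1 k),
        Submodule.fg_span (Set.finite_range _), fun y => ?_⟩
      have : (fun x => ρ (x * y) p.1 p.2) = ∑ k, (ρ y k p.2) • (fun x => ρ x p.1 k) := by
        funext x; simp [Matrix.mul_apply, mul_comm]
      change (fun x => ρ (x * y) p.1 p.2) ∈ _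
      rw [this]
      exact sum_mem fun k _ => Submodule.smul_mem _ _ (Submodule.subset_span ⟨k, rfl⟩)
    · refine ⟨Submodule.span K (Set.range fun k => fun x => ρ x⁻¹ k p.2),
        Submodule.fg_span (Set.finite_range _), fun y => ?_⟩
      have : (fun x => ρ (x * y)⁻¹ p.1 p.2) = ∑ k, (ρ y⁻¹ p.1 k) • (fun x => ρ x⁻¹ k p.2) := by
        funext x; simp [Matrix.mul_apply]
      change (fun x => ρ (x * y)⁻¹ p.1 p.2) ∈ _
      rw [this]
      exact sum_mem fun k _ => Submodule.smul_mem _ _ (Submodule.subset_span ⟨k, rfl⟩)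
  | algebraMap r =>
    exact ⟨Submodule.span K {fun _ => r}, Submodule.fg_span (Set.finite_singleton _),
      fun y => Submodule.mem_span_singleton_self _⟩
  | add a b _ _ ha hb =>
    obtain ⟨W, hW, h⟩ := ha
    obtain ⟨W', hW', h'⟩ := hb
    exact ⟨W ⊔ W', hW.sup hW', fun y => add_mem (Submodule.mem_sup_left (h y))
      (Submodule.mem_sup_right (h' y))⟩
  | mul a b _ _ ha hb =>
    obtain ⟨W, hW, h⟩ := ha
    obtain ⟨W', hW', h'⟩ := hb
    exact ⟨W * W', hW.mul hW', fun y => Submodule.mul_mem_mul (h y) (h' y)⟩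

theorem exists_rep {G K : Type*} [Group G] [Field K] {n : ℕ}
    {ρ : G →* Matrix (Fin n) (Fin n) K} {c : G → K} (hc : c ∈ regAlg ρ) :
    ∃ (d : ℕ) (σ : G →* Matrix (Fin d) (Fin d) K) (w l : Fin d → K),
      (∀ x, c x = l ⬝ᵥ (σ x *ᵥ w)) ∧
      (Submodule.span K (Set.range fun x => σ x *ᵥ w) = ⊤) ∧
      (∀ v, (∀ x, l ⬝ᵥ (σ x *ᵥ v) = 0) → v = 0) := by
  obtain ⟨W0, hW0, hcW⟩ := regAlg_translates hc
  let W : Submodule K (G → K) := Submodule.span K (Set.range fun y => fun x => c (x * y))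
  have hWle : W ≤ W0 := Submodule.span_le.2 (by rintro _ ⟨y, rfl⟩; exact hcW y)
  have : FiniteDimensional K W0 := Module.Finite.iff_fg.2 hW0
  have : FiniteDimensional K W := Submodule.finiteDimensional_of_le hWle
  let T : G → (G → K) →ₗ[K] (G → K) := fun y => LinearMap.funLeft K K (fun x => x * y)
  have hT : ∀ y f x, T y f x = f (x * y) := fun _ _ _ => rfl
  have hTW : ∀ y, ∀ f ∈ W, T y f ∈ W := by
    intro y f hf
    have : W ≤ W.comap (T y) := Submodule.span_le.2 (by
      rintro _ ⟨z, rfl⟩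
      refine Submodule.subset_span ⟨y * z, ?_⟩
      funext x
      simp [hT, mul_assoc])
    exact this hf
  let R : G →* Module.End K W :=
    { toFun := fun y => (T y).restrict (hTW y)
      map_one' := by ext f x; simp [hT]
      map_mul' := by intro a b; ext f x; simp [hT, mul_assoc] }
  have hR : ∀ y (f : W) x, (R y f).1 x = f.1 (x * y) := fun _ _ _ => rfl
  let b := Module.finBasis K W
  let cW : W := ⟨c, Submodule.subset_span ⟨1, by simp⟩⟩
  let σ : G →* Matrix (Fin (Module.finrank K W)) (Fin (Module.finrank K W)) K :=
    (LinearMap.toMatrixAlgEquiv b).toAlgHom.toRingHom.toMonoidHom.comp R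
  have hσ : ∀ x (f : W), σ x *ᵥ (b.repr f) = b.repr (R x f) := by
    intro x f
    exact LinearMap.toMatrix_mulVec_repr b b (R x) f
  let l : Fin (Module.finrank K W) → K := fun j => (b j).1 1
  have hl : ∀ f : W, l ⬝ᵥ (b.repr f) = f.1 1 := by
    intro f
    let ev : W →ₗ[K] K := (LinearMap.proj (1 : G)).comp W.subtype
    have hev : ∀ f : W, ev f = f.1 1 := fun _ => rfl
    have h1 := congrArg ev (b.sum_repr f)
    rw [map_sum] at h1
    rw [← hev, ← h1]
    refine Finset.sum_congr rfl fun j _ => ?_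
    rw [map_smul, smul_eq_mul, mul_comm]; rfl
  refine ⟨_, σ, b.repr cW, l, ?_, ?_, ?_⟩
  · intro x
    rw [hσ, hl, hR]; simp [cW]
  · rw [eq_top_iff]
    intro v _
    obtain ⟨f, hf⟩ : ∃ f : W, (b.repr f : _ → K) = v := ⟨b.equivFun.symm v, b.equivFun.apply_symm_apply v⟩
    rw [← hf]
    let e : W →ₗ[K] (Fin (Module.finrank K W) → K) := b.equivFun.toLinearMap
    have he : ∀ f, e f = b.repr f := fun f => rfl
    rw [← he]
    have key : ∀ f (hf : f ∈ W), e ⟨f, hf⟩ ∈ Submodule.span K (Set.range fun x => σ x *ᵥ (b.repr cW)) := by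
      intro f hf
      induction hf using Submodule.span_induction with
      | mem f hf1 =>
        obtain ⟨y, rfl⟩ := hf1
        refine Submodule.subset_span ⟨y, ?_⟩
        change σ y *ᵥ (b.repr cW) = _
        rw [hσ, he]; rfl
      | zero => exact (map_zero e) ▸ Submodule.zero_mem _
      | add x y hx hy h1 h2 =>
        have := add_mem h1 h2
        rw [← map_add] at this; exact this
      | smul a x hx h1 =>
        have := Submodule.smul_mem _ a h1
        rw [← map_smul] at this; exact this
    exact key f.1 f.2
  · intro v hv
    obtain ⟨f, hf⟩ : ∃ f : W, (b.repr f : _ → K) = v := ⟨b.equivFun.symm v, b.equivFun.apply_symm_apply v⟩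
    have : f = 0 := by
      apply Subtype.ext
      funext x
      have := hv x
      rw [← hf, hσ, hl, hR, one_mul] at this
      exact this
    rw [← hf, this, map_zero]; rfl

theorem pingpong {G V : Type*} [Group G] [MulAction G V] (b : Fin 2 → G)
    (a : Fin 2 × Bool → G) (ha : ∀ i, a (i, true) = b i) (ha' : ∀ i, a (i, false) = (b i)⁻¹)
    (U : Fin 2 × Bool → Set V) (p : V) (hp : ∀ s, p ∉ U s) (hps : ∀ s, a s • p ∈ U s)
    (hU : ∀ s t, t ≠ (s.1, !s.2) → ∀ v ∈ U t, a s • v ∈ U s) :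
    Function.Injective (FreeGroup.lift b) := by
  have key : ∀ (l : List (Fin 2 × Bool)) (s : Fin 2 × Bool), FreeGroup.IsReduced (s :: l) →
      FreeGroup.lift b (FreeGroup.mk (s :: l)) • p ∈ U s := by
    have h1 : ∀ s l, FreeGroup.lift b (FreeGroup.mk (s :: l)) =
        a s * FreeGroup.lift b (FreeGroup.mk l) := by
      rintro ⟨i, x⟩ l
      rw [FreeGroup.lift_mk, FreeGroup.lift_mk, List.map_cons, List.prod_cons]
      cases x <;> simp [ha, ha']
    intro l
    induction l with
    | nil =>
      intro s _
      have h2 : FreeGroup.mk ([] : List (Fin 2 × Bool)) = 1 := rfl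
      rw [h1, h2, map_one, mul_one]
      exact hps s
    | cons t l ih =>
      intro s hs
      rw [h1, mul_smul]
      rw [FreeGroup.isReduced_cons_cons] at hs
      refine hU s t ?_ _ (ih t hs.2)
      rintro rfl
      have := hs.1 rfl
      simp at this
  rw [injective_iff_map_eq_one]
  intro x hx
  by_contra hne
  have hr := FreeGroup.isReduced_toWord (x := x)
  have hw := FreeGroup.mk_toWord (x := x)
  cases hl : x.toWord with
  | nil => exact hne (FreeGroup.toWord_eq_nil_iff.1 hl)
  | cons s l =>
    rw [hl] at hr hw
    have := key l s hr
    rw [hw, hx, one_smul] at this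
    exact hp s this

open Matrix Filter Topology

theorem covec_span {G K : Type*} [Group G] [Field K] {d : ℕ}
    (σ : G →* Matrix (Fin d) (Fin d) K) (l : Fin d → K)
    (h3 : ∀ v, (∀ x, l ⬝ᵥ (σ x *ᵥ v) = 0) → v = 0) :
    Submodule.span K (Set.range fun x => l ᵥ* σ x) = ⊤ := by
  by_contra hne
  obtain ⟨f, hf, hle⟩ := Submodule.exists_le_ker_of_lt_top _ (lt_top_iff_ne_top.2 hne)
  apply hf
  let v : Fin d → K := fun i => f (Pi.single i 1)
  have hfv : ∀ u, f u = u ⬝ᵥ v := by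
    intro u
    conv_lhs => rw [← LinearMap.sum_single_apply _ u, map_sum]
    refine Finset.sum_congr rfl fun i _ => ?_
    rw [← mul_one (u i), ← smul_eq_mul, Pi.single_smul, map_smul,
      smul_eq_mul, smul_eq_mul, mul_one]
  have : v = 0 := by
    apply h3
    intro x
    rw [dotProduct_mulVec, ← hfv]
    exact hle (Submodule.subset_span ⟨x, rfl⟩)
  ext i
  simp [hfv, this]

theorem bilin_ind {K ι κ : Type*} [Field K] {d : ℕ} (a : ι → Fin d → K) (b : κ → Fin d → K)
    (ha : Submodule.span K (Set.range a) = ⊤) (hb : Submodule.span K (Set.range b) = ⊤)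
    (P : (Fin d → K) → (Fin d → K) → Prop) (hbase : ∀ i j, P (a i) (b j))
    (z1 : ∀ v, P 0 v) (z2 : ∀ v, P v 0)
    (a1 : ∀ u u' v, P u v → P u' v → P (u + u') v) (a2 : ∀ u v v', P u v → P u v' → P u (v + v'))
    (s1 : ∀ (r : K) u v, P u v → P (r • u) v) (s2 : ∀ (r : K) u v, P u v → P u (r • v)) :
    ∀ u v, P u v := by
  intro u v
  have hu : u ∈ Submodule.span K (Set.range a) := ha ▸ Submodule.mem_top
  induction hu using Submodule.span_induction with
  | mem u h =>
    obtain ⟨i, rfl⟩ := h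
    have hv : v ∈ Submodule.span K (Set.range b) := hb ▸ Submodule.mem_top
    induction hv using Submodule.span_induction with
    | mem u h =>
      obtain ⟨j, rfl⟩ := h
      exact hbase i j
    | zero => exact z2 _
    | add x y _ _ h h' => exact a2 _ _ _ h h'
    | smul r x _ h => exact s2 _ _ _ h
  | zero => exact z1 _
  | add x y _ _ h h' => exact a1 _ _ _ h h'
  | smul r x _ h => exact s1 _ _ _ h

theorem exists_pow_limit {L : Type*} [NormedField L]
    (hcomp : ∀ s : Set L, s.Finite → ∃ F : Subfield L, s ⊆ F ∧
      IsCompact ((F : Set L) ∩ Metric.closedBall 0 1)) {d : ℕ} (B : Matrix (Fin d) (Fin d) L)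
    (hB : ∀ m, B ^ m ≠ 0) : ∃ (φ : ℕ → ℕ) (r : ℕ → L) (Q : Matrix (Fin d) (Fin d) L), StrictMono φ ∧
      Q ≠ 0 ∧ Tendsto (fun j => r j • B ^ (φ j)) atTop (𝓝 Q) := by
  obtain ⟨F, hsF, hF⟩ := hcomp (Set.range fun p : Fin d × Fin d => B p.1 p.2) (Set.finite_range _)
  have hBF : ∀ m i j, (B ^ m) i j ∈ F := by
    intro m
    induction m with
    | zero =>
      intro i j
      rw [pow_zero, Matrix.one_apply]
      split_ifs
      · exact F.one_mem
      · exact F.zero_mem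
    | succ m ih =>
      intro i j
      rw [pow_succ, Matrix.mul_apply]
      exact sum_mem fun k _ => mul_mem (ih i k) (hsF ⟨(k, j), rfl⟩)
  have hmax : ∀ m, ∃ r : L, r ∈ F ∧ (∃ i j, r * (B ^ m) i j = 1) ∧ ∀ i j, ‖r * (B ^ m) i j‖ ≤ 1 := by
    intro m
    have : ∃ i j, (B ^ m) i j ≠ 0 := by
      by_contra! h
      exact hB m (by ext i j; exact h i j)
    obtain ⟨i0, j0, h0⟩ := this
    have : Nonempty (Fin d × Fin d) := ⟨(i0, j0)⟩
    obtain ⟨p, hp⟩ := Finite.exists_max (fun p : Fin d × Fin d => ‖(B ^ m) p.1 p.2‖)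
    have hpos : 0 < ‖(B ^ m) p.1 p.2‖ := lt_of_lt_of_le (norm_pos_iff.2 h0) (hp (i0, j0))
    refine ⟨((B ^ m) p.1 p.2)⁻¹, inv_mem (hBF _ _ _), ⟨p.1, p.2, inv_mul_cancel₀
      (norm_pos_iff.1 hpos)⟩, fun i j => ?_⟩
    rw [norm_mul, norm_inv, inv_mul_le_one₀ hpos]
    exact hp (i, j)
  choose r hrF hr1 hr2 using hmax
  let N : ℕ → Fin d → Fin d → L := fun m i j => r m * (B ^ m) i j
  let C : Set (Fin d → Fin d → L) := (Set.pi Set.univ fun _ => Set.pi Set.univ fun _ =>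
    (F : Set L) ∩ Metric.closedBall 0 1) ∩ ⋃ i, ⋃ j, {X | X i j = 1}
  have hC : IsCompact C := by
    refine IsCompact.inter_right (isCompact_univ_pi fun _ => isCompact_univ_pi fun _ => hF) ?_
    refine isClosed_iUnion_of_finite fun i => isClosed_iUnion_of_finite fun j => ?_
    exact isClosed_eq (by fun_prop) (by fun_prop)
  obtain ⟨Q, hQ, φ, hφ, hlim⟩ := hC.tendsto_subseq (x := N) (by
    intro m
    refine ⟨fun i _ j _ => ⟨mul_mem (hrF m) (hBF m i j), mem_closedBall_zero_iff.2 (hr2 m i j)⟩, ?_⟩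
    obtain ⟨i, j, h⟩ := hr1 m
    exact Set.mem_iUnion.2 ⟨i, Set.mem_iUnion.2 ⟨j, h⟩⟩)
  refine ⟨φ, fun j => r (φ j), Q, hφ, ?_, hlim⟩
  rintro rfl
  obtain ⟨i, hi⟩ := Set.mem_iUnion.1 hQ.2
  obtain ⟨j, hj⟩ := Set.mem_iUnion.1 hi
  exact zero_ne_one hj

theorem exists_unif {L ι : Type*} [NormedField L] [Finite ι] {d : ℕ} (f p : ι → Fin d → L)
    (h : ∀ i, f i ⬝ᵥ p i ≠ 0) : ∃ ε > 0, ∀ i, ∀ v ∈ Metric.ball (p i) ε, ε ≤ ‖f i ⬝ᵥ v‖ := by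
  have : ∀ i, ∀ᶠ ε : ℝ in 𝓝[>] 0, ∀ v ∈ Metric.ball (p i) ε, ε ≤ ‖f i ⬝ᵥ v‖ := by
    intro i
    have hcont : Continuous fun v : Fin d → L => ‖f i ⬝ᵥ v‖ := by
      unfold dotProduct; fun_prop
    have h1 : ∀ᶠ v in 𝓝 (p i), ‖f i ⬝ᵥ p i‖ / 2 < ‖f i ⬝ᵥ v‖ :=
      hcont.tendsto (p i) (Ioi_mem_nhds (half_lt_self (norm_pos_iff.2 (h i))))
    obtain ⟨e, he, hball⟩ := Metric.eventually_nhds_iff_ball.1 h1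
    have h2 : ∀ᶠ ε : ℝ in 𝓝[>] 0, ε < min e (‖f i ⬝ᵥ p i‖ / 2) :=
      nhdsWithin_le_nhds (Iio_mem_nhds (lt_min he (half_pos (norm_pos_iff.2 (h i)))))
    filter_upwards [h2] with ε hε v hv
    exact (hε.le.trans (min_le_right _ _)).trans
      (hball v (Metric.ball_subset_ball (hε.le.trans (min_le_left _ _)) hv)).le
  obtain ⟨ε, h1, h2⟩ := ((eventually_all.2 this).and self_mem_nhdsWithin).exists
  exact ⟨ε, h2, h1⟩

theorem mulVec_bound {L : Type*} [NormedField L] {d : ℕ} (C : Matrix (Fin d) (Fin d) L)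
    (v : Fin d → L) : ‖C *ᵥ v‖ ≤ (∑ i, ∑ j, ‖C i j‖) * ‖v‖ := by
  rw [pi_norm_le_iff_of_nonneg (by positivity)]
  intro i
  calc ‖(C *ᵥ v) i‖ ≤ ∑ j, ‖C i j * v j‖ := norm_sum_le Finset.univ (fun j => C i j * v j)
    _ ≤ ∑ j, ‖C i j‖ * ‖v‖ := by
      refine Finset.sum_le_sum fun j _ => ?_
      rw [norm_mul]; gcongr; exact norm_le_pi_norm v j
    _ = (∑ j, ‖C i j‖) * ‖v‖ := by rw [Finset.sum_mul]
    _ ≤ _ := by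
      refine mul_le_mul_of_nonneg_right ?_ (norm_nonneg v)
      exact Finset.single_le_sum (f := fun i => ∑ j, ‖C i j‖) (fun i _ => by positivity)
        (Finset.mem_univ i)

theorem exists_generic {G K ι : Type*} [Group G] [Field K] [Fintype ι] {n d : ℕ}
    {M : G →* Matrix (Fin n) (Fin n) K} (hM : Conn M) (σ : G →* Matrix (Fin d) (Fin d) K)
    (w : Fin d → K) (f : ι → Fin d → K)
    (hreg : ∀ f v, (fun z => f ⬝ᵥ (σ z *ᵥ v)) ∈ regAlg M)
    (hne : ∀ i, ∃ z, f i ⬝ᵥ (σ z *ᵥ w) ≠ 0) (N : ℕ) :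
    ∃ z : ℕ → G, ∀ a < N, ∀ b < N, a ≠ b → ∀ i, f i ⬝ᵥ (σ ((z a)⁻¹ * z b) *ᵥ w) ≠ 0 := by
  classical
  induction N with
  | zero => exact ⟨fun _ => 1, fun a ha => absurd ha (Nat.not_lt_zero a)⟩
  | succ N ih =>
    obtain ⟨z, hz⟩ := ih
    have h1 : ∀ (a : G) i, (fun x => f i ⬝ᵥ (σ (a⁻¹ * x) *ᵥ w)) ∈ regAlg M := by
      intro a i
      simpa using regAlg_two_sided a⁻¹ 1 (hreg (f i) w)
    have h2 : ∀ (a : G) i, (fun x => f i ⬝ᵥ (σ (x⁻¹ * a) *ᵥ w)) ∈ regAlg M := by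
      intro a i
      simpa using regAlg_two_sided a⁻¹ 1 (regAlg_inv (hreg (f i) w))
    obtain ⟨x, hx⟩ := hM.finset (Finset.univ : Finset ((Fin N × ι) × Bool))
      (fun p x => if p.2 then f p.1.2 ⬝ᵥ (σ ((z p.1.1)⁻¹ * x) *ᵥ w) else
        f p.1.2 ⬝ᵥ (σ (x⁻¹ * (z p.1.1)) *ᵥ w)) (by
        rintro ⟨⟨a, i⟩, b⟩ _
        cases b
        · exact h2 _ _
        · exact h1 _ _) (by
        rintro ⟨⟨a, i⟩, b⟩ _
        obtain ⟨y, hy⟩ := hne i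
        cases b
        · exact ⟨z a * y⁻¹, by simpa using hy⟩
        · exact ⟨z a * y, by simpa using hy⟩)
    refine ⟨Function.update z N x, fun a ha b hb hab i => ?_⟩
    rcases Nat.lt_succ_iff_lt_or_eq.1 ha with ha | rfl <;>
    rcases Nat.lt_succ_iff_lt_or_eq.1 hb with hb | rfl
    · rw [Function.update_of_ne ha.ne, Function.update_of_ne hb.ne]
      exact hz a ha b hb hab i
    · rw [Function.update_of_ne ha.ne, Function.update_self]
      simpa using hx ((⟨a, ha⟩, i), true) (Finset.mem_univ _)
    · rw [Function.update_of_ne hb.ne, Function.update_self]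
      simpa using hx ((⟨b, hb⟩, i), false) (Finset.mem_univ _)
    · exact absurd rfl hab

open Matrix Filter Topology

theorem free_of_c {G L : Type*} [Group G] [NormedField L] {n : ℕ}
    (hcomp : ∀ s : Set L, s.Finite → ∃ F : Subfield L, s ⊆ F ∧
      IsCompact ((F : Set L) ∩ Metric.closedBall 0 1))
    {M : G →* Matrix (Fin n) (Fin n) L} (hM : Conn M) (c : G → L) (hc : c ∈ regAlg M)
    (hc1 : c 1 = 1) (g : G) (Λ : L)
    (hlim : ∀ x y, Tendsto (fun m : ℕ => (Λ ^ m)⁻¹ * c (x * g ^ m * y)) atTop (𝓝 (c x * c y)))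
    (hnm : ∃ x y, c (x * y) ≠ c x * c y) :
    ∃ f : FreeGroup (Fin 2) →* G, Function.Injective f := by
  classical
  obtain ⟨d, σ, w, l, h1, h2, h3⟩ := exists_rep hc
  have h2' := covec_span σ l h3
  have hbase : ∀ x y (A : G), (l ᵥ* σ x) ⬝ᵥ (σ A *ᵥ (σ y *ᵥ w)) = c (x * A * y) := by
    intro x y A
    rw [h1, map_mul, map_mul, ← mulVec_mulVec, ← mulVec_mulVec, dotProduct_mulVec l]
  have hreg : ∀ f v, (fun z => f ⬝ᵥ (σ z *ᵥ v)) ∈ regAlg M := by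
    refine bilin_ind _ _ h2' h2 _ ?_ ?_ ?_ ?_ ?_ ?_ ?_
    · intro x y
      simp only [hbase]
      exact regAlg_two_sided x y hc
    · intro v; simpa using regAlg_const M 0
    · intro v; simpa using regAlg_const M 0
    · intro u u' v h h'
      simp only [add_dotProduct]; exact add_mem h h'
    · intro u u' v h h'
      simp only [mulVec_add, dotProduct_add]; exact add_mem h h'
    · intro r u v h
      simp only [smul_dotProduct]; exact Subalgebra.smul_mem _ h r
    · intro r u v h
      simp only [mulVec_smul, dotProduct_smul]; exact Subalgebra.smul_mem _ h r
  have hlw : l ⬝ᵥ w = 1 := by rw [← hc1, h1]; simp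
  have hlim2 : ∀ f v, Tendsto (fun m : ℕ => (Λ ^ m)⁻¹ * (f ⬝ᵥ (σ (g ^ m) *ᵥ v))) atTop
      (𝓝 ((f ⬝ᵥ w) * (l ⬝ᵥ v))) := by
    refine bilin_ind _ _ h2' h2 _ ?_ ?_ ?_ ?_ ?_ ?_ ?_
    · intro x y
      simp only [hbase, ← h1, ← dotProduct_mulVec]
      exact hlim x y
    · intro v; simp
    · intro v; simp
    · intro u u' v h h'
      simp only [add_dotProduct, mul_add, add_mul]; exact h.add h'
    · intro u u' v h h'
      simp only [mulVec_add, dotProduct_add, mul_add]; exact h.add h'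
    · intro r u v h
      simp only [smul_dotProduct, smul_eq_mul, mul_assoc, mul_left_comm _ r]
      exact h.const_mul r
    · intro r u v h
      simp only [mulVec_smul, dotProduct_smul, smul_eq_mul, mul_left_comm _ r]
      exact h.const_mul r
  have hlim3 : Tendsto (fun m : ℕ => (Λ ^ m)⁻¹ • σ (g ^ m)) atTop (𝓝 (vecMulVec w l)) := by
    refine tendsto_pi_nhds.2 fun i => tendsto_pi_nhds.2 fun j => ?_
    have := hlim2 (Pi.single i 1) (Pi.single j 1)
    simpa [vecMulVec_apply] using this
  have hcyc : ∀ f : Fin d → L, f ≠ 0 → ∃ z, f ⬝ᵥ (σ z *ᵥ w) ≠ 0 := by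
    intro f hf
    by_contra! h
    apply hf
    have : ∀ v, f ⬝ᵥ v = 0 := by
      intro v
      have hv : v ∈ Submodule.span L (Set.range fun x => σ x *ᵥ w) := h2 ▸ Submodule.mem_top
      induction hv using Submodule.span_induction with
      | mem u hu => obtain ⟨z, rfl⟩ := hu; exact h z
      | zero => simp
      | add x y _ _ hx hy => rw [dotProduct_add, hx, hy, add_zero]
      | smul r x _ hx => rw [dotProduct_smul, hx, smul_zero]
    funext i
    simpa using this (Pi.single i 1)
  -- the functional eta
  obtain ⟨x0, y0, hxy⟩ := hnm
  obtain ⟨η, hη0, hηw⟩ : ∃ η : Fin d → L, η ≠ 0 ∧ η ⬝ᵥ w = 0 := by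
    refine ⟨l ᵥ* σ x0 - c x0 • l, ?_, ?_⟩
    · intro h0
      apply hxy
      have := congrArg (fun u => u ⬝ᵥ (σ y0 *ᵥ w)) h0
      simp only [sub_dotProduct, smul_dotProduct, zero_dotProduct, ← dotProduct_mulVec, smul_eq_mul,
        ← h1, mulVec_mulVec, ← map_mul] at this
      exact sub_eq_zero.1 this
    · rw [sub_dotProduct, ← dotProduct_mulVec, ← h1, smul_dotProduct, hlw, smul_eq_mul, mul_one,
        sub_self]
  have hw0 : w ≠ 0 := by rintro rfl; simp at hlw
  have hpow : ∀ m, (σ g⁻¹) ^ m ≠ 0 := by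
    intro m h0
    have h4 : σ (g ^ m) * (σ g⁻¹) ^ m = 1 := by
      rw [← map_pow, ← map_mul, inv_pow, mul_inv_cancel, map_one]
    rw [h0, mul_zero] at h4
    apply hw0
    rw [← one_mulVec w, ← h4, zero_mulVec]
  obtain ⟨φ, r, Q, hφ, hQ, hQlim⟩ := exists_pow_limit hcomp (σ g⁻¹) hpow
  obtain ⟨i0, j0, hQ0⟩ : ∃ i j, Q i j ≠ 0 := by
    by_contra! h
    exact hQ (by ext i j; exact h i j)
  have hv0 : Q *ᵥ (Pi.single j0 1) ≠ 0 := by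
    intro h
    apply hQ0
    simpa using congrFun h i0
  obtain ⟨x1, hx1⟩ : ∃ x, l ⬝ᵥ (σ x *ᵥ (Q *ᵥ (Pi.single j0 1))) ≠ 0 := by
    by_contra! h
    exact hv0 (h3 _ h)
  obtain ⟨h, hh⟩ := hM.finset (Finset.univ : Finset Bool)
    (fun b x => if b then l ⬝ᵥ (σ x *ᵥ (Q *ᵥ (Pi.single j0 1))) else
      l ⬝ᵥ (σ x⁻¹ *ᵥ (Q *ᵥ (Pi.single j0 1)))) (by
      rintro b _
      cases b
      · exact regAlg_inv (hreg _ _)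
      · exact hreg _ _) (by
      rintro b _
      cases b
      · exact ⟨x1⁻¹, by simpa using hx1⟩
      · exact ⟨x1, by simpa using hx1⟩)
  let hb : Bool → G := fun b => if b then h else h⁻¹
  let ξ : Bool → Fin d → L := fun b => l ᵥ* (σ (hb b) * Q)
  have hξ : ∀ b, ξ b ≠ 0 := by
    intro b h0
    have h5 : ξ b ⬝ᵥ (Pi.single j0 1) = 0 := by rw [h0, zero_dotProduct]
    have := hh b (Finset.mem_univ _)
    simp only [ξ, ← dotProduct_mulVec, ← mulVec_mulVec] at h5
    cases b
    · exact this h5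
    · exact this h5
  obtain ⟨z', hz'⟩ := exists_generic hM σ w (fun o : Option Bool => o.elim η ξ) hreg (by
    rintro (_ | b)
    · exact hcyc _ hη0
    · exact hcyc _ (hξ b)) (Fintype.card (Option (Fin 2 × Bool)))
  let z : Option (Fin 2 × Bool) → G := fun o => z' (Fintype.equivFin _ o)
  have hz : ∀ a b, a ≠ b → ∀ o : Option Bool,
      (o.elim η ξ) ⬝ᵥ (σ ((z a)⁻¹ * z b) *ᵥ w) ≠ 0 := by
    intro a b hab o
    refine hz' _ (Fin.is_lt _) _ (Fin.is_lt _) ?_ o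
    intro h
    exact hab ((Fintype.equivFin _).injective (Fin.ext h))
  let bar : Fin 2 × Bool → Fin 2 × Bool := fun s => (s.1, !s.2)
  let p : Option (Fin 2 × Bool) → Fin d → L := fun o => σ (z o) *ᵥ w
  let q : Fin 2 × Bool → Fin d → L := fun s => ξ s.2 ᵥ* σ (z (some (bar s)))⁻¹
  let q0 : Fin d → L := η ᵥ* σ (z none)⁻¹
  -- index type of pairs
  let I := {x : Option (Fin 2 × Bool) × Option (Fin 2 × Bool) // x.1 ≠ x.2.map bar ∧
    (x.2 = none → x.1 ≠ none)}
  let fI : I → Fin d → L := fun x => x.1.2.elim q0 q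
  let pI : I → Fin d → L := fun x => p x.1.1
  obtain ⟨ε, hε, hball⟩ := exists_unif fI pI (by
    rintro ⟨⟨t, s⟩, h1, h2⟩
    rcases s with _ | s
    · simp only [fI, pI, Option.elim, q0, p]
      rw [← dotProduct_mulVec, mulVec_mulVec, ← map_mul]
      exact hz none t (Ne.symm (h2 rfl)) none
    · simp only [fI, pI, Option.elim, q, p]
      rw [← dotProduct_mulVec, mulVec_mulVec, ← map_mul]
      exact hz (some (bar s)) t (Ne.symm h1) (some s.2))
  have hball1 : ∀ s t, t ≠ some (bar s) → ∀ v ∈ Metric.ball (p t) ε, ε ≤ ‖q s ⬝ᵥ v‖ := by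
    intro s t hst v hv
    exact hball ⟨(t, some s), by simpa using hst, by simp⟩ v hv
  have hball2 : ∀ t, t ≠ none → ∀ v ∈ Metric.ball (p t) ε, q0 ⬝ᵥ v ≠ 0 := by
    intro t ht v hv h0
    have := hball ⟨(t, none), by simpa using ht, fun _ => ht⟩ v hv
    simp only [fI, Option.elim, h0, norm_zero] at this
    exact absurd this (not_le.2 hε)
  -- the elements
  let a : ℕ → Fin 2 × Bool → G := fun j s =>
    z (some s) * (g ^ φ j * hb s.2 * (g⁻¹) ^ φ j) * (z (some (bar s)))⁻¹
  let α : ℕ → L := fun j => (Λ ^ φ j)⁻¹ * r j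
  let R : Fin 2 × Bool → Matrix (Fin d) (Fin d) L := fun s =>
    σ (z (some s)) * (vecMulVec w l * σ (hb s.2) * Q) * σ (z (some (bar s)))⁻¹
  have hR : ∀ s v, R s *ᵥ v = (q s ⬝ᵥ v) • p (some s) := by
    intro s v
    simp only [R, ← mulVec_mulVec, q, p, ξ, ← dotProduct_mulVec]
    rw [vecMulVec_mulVec, mulVec_smul]
    simp
  have hlimR : ∀ s, Tendsto (fun j => α j • σ (a j s)) atTop (𝓝 (R s)) := by
    intro s
    have e1 := ((hlim3.comp hφ.tendsto_atTop).mul (tendsto_const_nhds (x := σ (hb s.2)))).mul hQlim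
    have e2 := ((tendsto_const_nhds (x := σ (z (some s)))).mul e1).mul
      (tendsto_const_nhds (x := σ (z (some (bar s)))⁻¹))
    refine e2.congr fun j => ?_
    simp only [a, α, map_mul, map_pow, Function.comp_apply, smul_mul_assoc, mul_smul_comm, smul_smul]
    rw [mul_comm (r j)]
  have hev : ∀ s t, ∀ᶠ j in atTop,
      (∑ i, ∑ k, ‖(α j • σ (a j s) - R s) i k‖) * (‖p t‖ + ε) < ε * ε := by
    intro s t
    have e3 : Tendsto (fun j => (∑ i, ∑ k, ‖(α j • σ (a j s) - R s) i k‖) * (‖p t‖ + ε)) atTop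
        (𝓝 ((∑ i : Fin d, ∑ k : Fin d, ‖((0 : Matrix (Fin d) (Fin d) L)) i k‖) * (‖p t‖ + ε))) := by
      have e4 : Tendsto (fun j => α j • σ (a j s) - R s) atTop (𝓝 0) := by
        simpa using (hlimR s).sub_const (R s)
      refine Tendsto.mul_const _ (tendsto_finsetSum _ fun i _ => tendsto_finsetSum _ fun k _ => ?_)
      exact (tendsto_pi_nhds.1 (tendsto_pi_nhds.1 e4 i) k).norm
    have e5 : (∑ i : Fin d, ∑ k : Fin d, ‖((0 : Matrix (Fin d) (Fin d) L)) i k‖) * (‖p t‖ + ε)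
        < ε * ε := by simp; positivity
    exact e3.eventually (gt_mem_nhds e5)
  obtain ⟨j, hj⟩ := (eventually_all.2 fun s => eventually_all.2 fun t => hev s t).exists
  have hmap : ∀ s t, t ≠ some (bar s) → ∀ v ∈ Metric.ball (p t) ε,
      ∃ r : L, r • (σ (a j s) *ᵥ v) ∈ Metric.ball (p (some s)) ε := by
    intro s t hst v hv
    have hq := hball1 s t hst v hv
    have hqpos : 0 < ‖q s ⬝ᵥ v‖ := hε.trans_le hq
    refine ⟨(q s ⬝ᵥ v)⁻¹ * α j, ?_⟩
    have e6 : ((q s ⬝ᵥ v)⁻¹ * α j) • (σ (a j s) *ᵥ v) - p (some s) =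
        (q s ⬝ᵥ v)⁻¹ • ((α j • σ (a j s) - R s) *ᵥ v) := by
      rw [sub_mulVec, hR, smul_sub, smul_smul, inv_mul_cancel₀ (norm_pos_iff.1 hqpos), one_smul,
        smul_mulVec, smul_smul]
    rw [mem_ball_iff_norm, e6, norm_smul, norm_inv, inv_mul_lt_iff₀ hqpos]
    have hvn : ‖v‖ ≤ ‖p t‖ + ε := by
      have := norm_le_norm_add_norm_sub (p t) v
      rw [mem_ball_iff_norm, norm_sub_rev] at hv
      linarith
    calc _ ≤ (∑ i, ∑ k, ‖(α j • σ (a j s) - R s) i k‖) * ‖v‖ := mulVec_bound _ _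
      _ ≤ (∑ i, ∑ k, ‖(α j • σ (a j s) - R s) i k‖) * (‖p t‖ + ε) := by gcongr
      _ < ε * ε := hj s t
      _ ≤ _ := by gcongr
  let act : MulAction G (Fin d → L) :=
    { smul := fun x v => σ x *ᵥ v
      one_smul := fun v => by change σ 1 *ᵥ v = v; simp
      mul_smul := fun x y v => by
        change σ (x * y) *ᵥ v = σ x *ᵥ (σ y *ᵥ v); simp }
  have hact : ∀ (x : G) (v : Fin d → L), x • v = σ x *ᵥ v := fun _ _ => rfl
  refine ⟨_, pingpong (fun i => a j (i, true)) (a j) (fun i => rfl) (fun i => ?_)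
    (fun s => {v | ∃ r : L, r • v ∈ Metric.ball (p (some s)) ε}) (p none) ?_ ?_ ?_⟩
  · simp [a, hb, bar, mul_assoc]
  · rintro s ⟨r, hr⟩
    refine hball2 (some s) (by simp) _ hr ?_
    simp only [q0, p, dotProduct_smul, ← dotProduct_mulVec, mulVec_mulVec, ← map_mul]
    simp [hηw]
  · intro s
    exact hmap s none (by simp) _ (Metric.mem_ball_self hε)
  · rintro s t hst v ⟨r, hr⟩
    obtain ⟨r', hr'⟩ := hmap s (some t) (by simpa using hst) _ hr
    refine ⟨r' * r, ?_⟩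
    rw [hact, mul_smul, ← mulVec_smul]
    exact hr'

open Matrix Filter Topology

theorem regAlg_theta {G K L : Type*} [Group G] [Field K] [Field L] [Algebra K L] {n : ℕ}
    (ρ : G →* Matrix (Fin n) (Fin n) K) (f : G → L)
    (hf : f ∈ regAlg ((algebraMap K L).mapMatrix.toMonoidHom.comp ρ)) (θ : L →ₗ[K] K) :
    (fun x => θ (f x)) ∈ regAlg ρ := by
  let j : (G → K) →* (G → L) := ((algebraMap K L).compLeft G).toMonoidHom
  have hj : ∀ a x, j a x = algebraMap K L (a x) := fun _ _ => rfl
  let S : Submonoid (G → L) := (regAlg ρ).toSubmonoid.map j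
  have hle : regAlg ((algebraMap K L).mapMatrix.toMonoidHom.comp ρ) ≤ Algebra.adjoin L (S : Set (G → L)) := by
    refine Algebra.adjoin_mono ?_
    rintro _ (⟨p, rfl⟩ | ⟨p, rfl⟩)
    · exact ⟨_, regAlg_entry ρ p.1 p.2, rfl⟩
    · exact ⟨_, regAlg_entry_inv ρ p.1 p.2, rfl⟩
  have hsp : f ∈ Submodule.span L (S : Set (G → L)) := by
    have : Subalgebra.toSubmodule (Algebra.adjoin L (S : Set (G → L))) = Submodule.span L (S : Set (G → L)) := by
      rw [Algebra.adjoin_eq_span, Submonoid.closure_eq]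
    rw [← this]; exact hle hf
  clear hf
  induction hsp using Submodule.span_induction generalizing θ with
  | mem f h =>
    obtain ⟨a, ha, rfl⟩ := h
    have : (fun x => θ (j a x)) = fun x => a x * θ 1 := by
      funext x
      rw [hj, Algebra.algebraMap_eq_smul_one, map_smul, smul_eq_mul]
    rw [this]
    exact mul_mem ha (regAlg_const ρ (θ 1))
  | zero => simpa using regAlg_const ρ 0
  | add a b _ _ ha hb =>
    simp only [Pi.add_apply, map_add]
    exact add_mem (ha θ) (hb θ)
  | smul r a _ ha =>
    exact ha (θ.comp (LinearMap.mulLeft K r))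

theorem Conn.baseChange {G K L : Type*} [Group G] [Field K] [Field L] (φ : K →+* L) {n : ℕ}
    {ρ : G →* Matrix (Fin n) (Fin n) K} (hρ : Conn ρ) : Conn (φ.mapMatrix.toMonoidHom.comp ρ) := by
  let _ : Algebra K L := φ.toAlgebra
  intro f₁ h₁ f₂ h₂ h0
  by_contra! hne
  obtain ⟨⟨x, hx⟩, ⟨y, hy⟩⟩ := hne
  have hth : ∀ a : L, a ≠ 0 → ∃ θ : L →ₗ[K] K, θ a ≠ 0 := by
    intro a ha
    by_contra! h
    exact ha ((Module.forall_dual_apply_eq_zero_iff K a).1 h)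
  obtain ⟨θ₁, hθ₁⟩ := hth _ hx
  obtain ⟨θ₂, hθ₂⟩ := hth _ hy
  have := hρ.finset (Finset.univ : Finset Bool) (fun b x => if b then θ₁ (f₁ x) else θ₂ (f₂ x))
    (by
      rintro (_ | _) _
      · exact regAlg_theta ρ f₂ h₂ θ₂
      · exact regAlg_theta ρ f₁ h₁ θ₁)
    (by
      rintro (_ | _) _
      · exact ⟨y, by simpa using hθ₂⟩
      · exact ⟨x, by simpa using hθ₁⟩)
  obtain ⟨z, hz⟩ := this
  have z1 := hz true (Finset.mem_univ _)
  have z2 := hz false (Finset.mem_univ _)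
  rcases mul_eq_zero.1 (h0 z) with h | h
  · simp [h] at z1
  · simp [h] at z2

open Matrix Filter Topology

theorem rec_tendsto {L : Type*} [NormedField L] (u : ℕ → L) (a : L) (ha : ‖a‖ < 1)
    (h : Tendsto (fun m => u (m + 1) - a * u m) atTop (𝓝 0)) : Tendsto u atTop (𝓝 0) := by
  rw [Metric.tendsto_atTop]
  intro ε hε
  have h1 : 0 < 1 - ‖a‖ := by linarith
  rw [Metric.tendsto_atTop] at h
  obtain ⟨N, hN⟩ := h (ε / 2 * (1 - ‖a‖)) (by positivity)
  have hstep : ∀ m ≥ N, ‖u (m + 1)‖ - ε / 2 ≤ ‖a‖ * (‖u m‖ - ε / 2) := by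
    intro m hm
    have h2 := hN m hm
    rw [dist_zero_right] at h2
    have h3 : ‖u (m + 1)‖ ≤ ‖u (m + 1) - a * u m‖ + ‖a‖ * ‖u m‖ := by
      rw [← norm_mul]
      simpa using norm_add_le (u (m + 1) - a * u m) (a * u m)
    nlinarith
  have hind : ∀ k, ‖u (N + k)‖ - ε / 2 ≤ ‖a‖ ^ k * (‖u N‖ - ε / 2) := by
    intro k
    induction k with
    | zero => simp
    | succ k ih =>
      calc _ ≤ ‖a‖ * (‖u (N + k)‖ - ε / 2) := hstep (N + k) (by omega)
        _ ≤ ‖a‖ * (‖a‖ ^ k * (‖u N‖ - ε / 2)) := by gcongr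
        _ = _ := by ring
  have hlim : Tendsto (fun k => ‖a‖ ^ k * (‖u N‖ - ε / 2)) atTop (𝓝 0) := by
    simpa using (tendsto_pow_atTop_nhds_zero_of_lt_one (norm_nonneg a) ha).mul_const (‖u N‖ - ε / 2)
  obtain ⟨k, hk⟩ := eventually_atTop.1 (hlim.eventually (gt_mem_nhds (half_pos hε)))
  refine ⟨N + k, fun m hm => ?_⟩
  rw [dist_zero_right]
  obtain ⟨j, rfl⟩ : ∃ j, m = N + j := ⟨m - N, by omega⟩
  have := hk j (by omega)
  have := hind j
  linarith

theorem rec_tendsto_mat {L : Type*} [NormedField L] {n : ℕ} (u : ℕ → Matrix (Fin n) (Fin n) L)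
    (a : L) (ha : ‖a‖ < 1)
    (h : Tendsto (fun m => u (m + 1) - a • u m) atTop (𝓝 0)) : Tendsto u atTop (𝓝 0) := by
  refine tendsto_pi_nhds.2 fun i => tendsto_pi_nhds.2 fun j => ?_
  exact rec_tendsto (fun m => u m i j) a ha (tendsto_pi_nhds.1 (tendsto_pi_nhds.1 h i) j)

theorem killed_pow {L : Type*} [NormedField L] {n : ℕ} (B : Matrix (Fin n) (Fin n) L) (t : L)
    (S : Multiset L) (hS : ∀ a ∈ S, ‖t * a‖ < 1) (E : Matrix (Fin n) (Fin n) L)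
    (hE : Polynomial.aeval B (S.map fun a => Polynomial.X - Polynomial.C a).prod * E = 0) :
    Tendsto (fun m => (t • B) ^ m * E) atTop (𝓝 0) := by
  induction S using Multiset.induction_on generalizing E with
  | empty =>
    simp at hE
    simp [hE]
  | cons a S ih =>
    rw [Multiset.map_cons, Multiset.prod_cons, mul_comm, map_mul, mul_assoc] at hE
    have h1 := ih (fun b hb => hS b (Multiset.mem_cons_of_mem hb)) _ hE
    refine rec_tendsto_mat _ (t * a) (hS a (Multiset.mem_cons_self a S)) ?_
    have h2 := h1.const_smul t
    rw [smul_zero] at h2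
    refine h2.congr fun m => ?_
    rw [map_sub, Polynomial.aeval_X, Polynomial.aeval_C, Algebra.algebraMap_eq_smul_one, sub_mul,
      mul_sub, smul_sub, pow_succ, smul_mul_assoc, one_mul, mul_smul_comm, smul_smul, mul_assoc,
      smul_mul_assoc, mul_smul_comm]

theorem killed_pow_inv {L : Type*} [NormedField L] {n : ℕ} (B B' : Matrix (Fin n) (Fin n) L)
    (hB : B' * B = 1) (t : L)
    (S : Multiset L) (hS : ∀ a ∈ S, ‖t‖ < ‖a‖) (E : Matrix (Fin n) (Fin n) L)
    (hE : Polynomial.aeval B (S.map fun a => Polynomial.X - Polynomial.C a).prod * E = 0) :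
    Tendsto (fun m => (t • B') ^ m * E) atTop (𝓝 0) := by
  induction S using Multiset.induction_on generalizing E with
  | empty =>
    simp at hE
    simp [hE]
  | cons a S ih =>
    rw [Multiset.map_cons, Multiset.prod_cons, mul_comm, map_mul, mul_assoc] at hE
    have h1 := ih (fun b hb => hS b (Multiset.mem_cons_of_mem hb)) _ hE
    have ha := hS a (Multiset.mem_cons_self a S)
    have ha0 : 0 < ‖a‖ := lt_of_le_of_lt (norm_nonneg _) ha
    have ha1 : a ≠ 0 := norm_pos_iff.1 ha0
    refine rec_tendsto_mat _ (t / a) (by rw [norm_div, div_lt_one ha0]; exact ha) ?_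
    have h2 := ((tendsto_add_atTop_iff_nat 1).2 h1).const_smul (-a⁻¹)
    rw [smul_zero] at h2
    refine h2.congr fun m => ?_
    rw [map_sub, Polynomial.aeval_X, Polynomial.aeval_C, Algebra.algebraMap_eq_smul_one, sub_mul,
      mul_sub, smul_sub, smul_mul_assoc, one_mul, mul_smul_comm, smul_smul, neg_mul,
      inv_mul_cancel₀ ha1, neg_smul, neg_smul, one_smul, sub_neg_eq_add]
    have h3 : (t • B') ^ (m + 1) * (B * E) = t • ((t • B') ^ m * E) := by
      rw [pow_succ, mul_assoc, smul_mul_assoc, ← mul_assoc B', hB, one_mul, mul_smul_comm]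
    rw [h3, smul_smul, div_eq_inv_mul]; abel

theorem exists_proj {L : Type*} [NormedField L] [IsAlgClosed L] {n : ℕ}
    (B B' : Matrix (Fin n) (Fin n) L) (hB : B' * B = 1)
    (hev : ∃ a, B.charpoly.IsRoot a ∧ 1 < ‖a‖) :
    ∃ (P : Matrix (Fin n) (Fin n) L) (s : L), s ≠ 0 ∧ P * P = P ∧ B * P = P * B ∧ P ≠ 0 ∧
      Tendsto (fun m => (s⁻¹ • B) ^ m * (1 - P)) atTop (𝓝 0) ∧
      Tendsto (fun m => (s • B') ^ m * P) atTop (𝓝 0) ∧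
      Tendsto (fun m => B' ^ m * P) atTop (𝓝 0) := by
  classical
  obtain ⟨a, ha, ha1⟩ := hev
  have hmon := B.charpoly_monic
  have hsplit := (IsAlgClosed.splits B.charpoly).eq_prod_roots_of_monic hmon
  let E := B.charpoly.roots.filter (fun a => 1 < ‖a‖)
  let F := B.charpoly.roots.filter (fun a => ¬ 1 < ‖a‖)
  let pE := (E.map fun a => Polynomial.X - Polynomial.C a).prod
  let pF := (F.map fun a => Polynomial.X - Polynomial.C a).prod
  have hprod : B.charpoly = pE * pF := by
    rw [hsplit, ← Multiset.prod_add, ← Multiset.map_add, Multiset.filter_add_not]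
  have hcop : IsCoprime pE pF := by
    have h1 : ∀ b, 1 < ‖b‖ → IsCoprime (Polynomial.X - Polynomial.C b) pF := by
      intro b hb
      refine IsCoprime.symm ?_
      refine Multiset.prod_induction (fun q => IsCoprime q (Polynomial.X - Polynomial.C b)) _
        (fun _ _ => IsCoprime.mul_left) isCoprime_one_left ?_
      intro q hq
      obtain ⟨r, hr, rfl⟩ := Multiset.mem_map.1 hq
      have hr := (Multiset.mem_filter.1 hr).2
      refine Polynomial.isCoprime_X_sub_C_of_isUnit_sub (IsUnit.mk0 _ (sub_ne_zero.2 ?_))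
      rintro rfl
      exact hr hb
    refine Multiset.prod_induction (fun q => IsCoprime q pF) _
        (fun _ _ => IsCoprime.mul_left) isCoprime_one_left ?_
    intro q hq
    obtain ⟨r, hr, rfl⟩ := Multiset.mem_map.1 hq
    exact h1 r (Multiset.mem_filter.1 hr).2
  obtain ⟨u, v, huv⟩ := hcop
  have haE : a ∈ E := Multiset.mem_filter.2 ⟨(Polynomial.mem_roots hmon.ne_zero).2 ha, ha1⟩
  obtain ⟨a0, ha0, hmin⟩ := Finset.exists_min_image E.toFinset (fun b => ‖b‖)
    ⟨a, Multiset.mem_toFinset.2 haE⟩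
  obtain ⟨s, hs⟩ := IsAlgClosed.exists_pow_nat_eq a0 (n := 2) (by norm_num)
  have ha01 : 1 < ‖a0‖ := (Multiset.mem_filter.1 (Multiset.mem_toFinset.1 ha0)).2
  have hs2 : ‖s‖ ^ 2 = ‖a0‖ := by rw [← norm_pow, hs]
  have hs1 : 1 < ‖s‖ := by
    by_contra! h
    have := pow_le_one₀ (norm_nonneg s) h (n := 2)
    linarith
  have hs3 : ‖s‖ < ‖a0‖ := by nlinarith
  have hs0 : s ≠ 0 := norm_pos_iff.1 (by linarith)
  have hch : Polynomial.aeval B (pE * pF) = 0 := by rw [← hprod]; exact Matrix.aeval_self_charpoly B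
  have hP1 : 1 - Polynomial.aeval B (v * pF) = Polynomial.aeval B (u * pE) := by
    have := congrArg (Polynomial.aeval B) huv
    rw [map_add, map_one] at this
    rw [← this]; abel
  have hEP : Polynomial.aeval B pE * Polynomial.aeval B (v * pF) = 0 := by
    rw [← map_mul, show pE * (v * pF) = v * (pE * pF) by ring, map_mul, hch, mul_zero]
  have hFP : Polynomial.aeval B pF * (1 - Polynomial.aeval B (v * pF)) = 0 := by
    rw [hP1, ← map_mul, show pF * (u * pE) = u * (pE * pF) by ring, map_mul, hch, mul_zero]
  have hFlim := killed_pow B s⁻¹ F (by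
      intro b hb
      have hb := not_lt.1 (Multiset.mem_filter.1 hb).2
      rw [norm_mul, norm_inv, inv_mul_lt_iff₀ (by linarith), mul_one]
      linarith) _ hFP
  refine ⟨Polynomial.aeval B (v * pF), s, hs0, ?_, ?_, ?_, hFlim, ?_, ?_⟩
  · have : Polynomial.aeval B (v * pF) * (1 - Polynomial.aeval B (v * pF)) = 0 := by
      rw [map_mul, mul_assoc, ← map_mul, hFP, mul_zero]
    rw [mul_sub, mul_one, sub_eq_zero] at this
    exact this.symm
  · have : Commute (Polynomial.aeval B (Polynomial.X : Polynomial L))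
        (Polynomial.aeval B (v * pF)) := by
      unfold Commute SemiconjBy
      rw [← map_mul, mul_comm, map_mul]
    rw [Polynomial.aeval_X] at this
    exact this
  · intro h0
    rw [h0, sub_zero] at hFlim
    have hdet : (Matrix.scalar (Fin n) a - B).det = 0 := by
      rw [← Matrix.eval_charpoly]; exact ha
    obtain ⟨x, hx0, hx⟩ := Matrix.exists_mulVec_eq_zero_iff.2 hdet
    have hBx : B *ᵥ x = a • x := by
      rw [sub_mulVec, sub_eq_zero] at hx
      rw [← hx]; ext i; simp [Matrix.scalar_apply, Matrix.mulVec_diagonal]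
    have hpow : ∀ m : ℕ, (s⁻¹ • B) ^ m *ᵥ x = (s⁻¹ * a) ^ m • x := by
      intro m
      induction m with
      | zero => simp
      | succ m ih =>
        rw [pow_succ', ← mulVec_mulVec, ih, mulVec_smul, smul_mulVec, hBx, smul_smul, smul_smul,
          pow_succ, mul_assoc]
    obtain ⟨i, hi⟩ : ∃ i, x i ≠ 0 := by
      by_contra! h; exact hx0 (funext h)
    have hl : Tendsto (fun m => ‖((s⁻¹ • B) ^ m *ᵥ x) i‖) atTop (𝓝 0) := by
      have h5 : Continuous fun C : Matrix (Fin n) (Fin n) L => ‖(C *ᵥ x) i‖ := by fun_prop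
      have := (h5.tendsto 0).comp hFlim
      simpa [Function.comp_def] using this
    obtain ⟨m, hm⟩ := (hl.eventually (gt_mem_nhds (norm_pos_iff.2 hi))).exists
    rw [hpow, Pi.smul_apply, smul_eq_mul, norm_mul] at hm
    have h6 : 1 ≤ ‖(s⁻¹ * a) ^ m‖ := by
      rw [norm_pow]
      refine one_le_pow₀ ?_
      rw [norm_mul, norm_inv, le_inv_mul_iff₀ (by linarith), mul_one]
      exact hs3.le.trans (hmin a (Multiset.mem_toFinset.2 haE))
    nlinarith [norm_nonneg (x i)]
  · exact killed_pow_inv B B' hB s E (fun b hb => hs3.trans_le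
      (hmin b (Multiset.mem_toFinset.2 hb))) _ hEP
  · have := killed_pow_inv B B' hB 1 E (fun b hb => by
      rw [norm_one]; exact (Multiset.mem_filter.1 hb).2) _ hEP
    simpa using this

theorem det_block_swap {L : Type*} [CommRing L] {n : ℕ} (A X Y : Matrix (Fin n) (Fin n) L) :
    (fromBlocks A (-Y) X 0).det = X.det * Y.det := by
  have hJ : (fromBlocks (0 : Matrix (Fin n) (Fin n) L) 1 (-1) (0 : Matrix (Fin n) (Fin n) L)).det = 1 := by
    have : fromBlocks (0 : Matrix (Fin n) (Fin n) L) 1 (-1) (0 : Matrix (Fin n) (Fin n) L) =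
        fromBlocks 1 1 0 1 * (fromBlocks 1 0 (-1) 1 * fromBlocks 1 1 0 1) := by
      simp [fromBlocks_multiply]
    rw [this, det_mul, det_mul, det_fromBlocks_zero₂₁, det_fromBlocks_zero₁₂]
    simp
  have h2 : fromBlocks A (-Y) X 0 * fromBlocks (0 : Matrix (Fin n) (Fin n) L) 1 (-1)
      (0 : Matrix (Fin n) (Fin n) L) =
      fromBlocks Y A 0 X := by simp [fromBlocks_multiply]
  rw [← mul_one (fromBlocks A (-Y) X 0).det, ← hJ, ← det_mul, h2, det_fromBlocks_zero₂₁, mul_comm]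

theorem ring_id1 {R : Type*} [Ring R] (P E x y : R) (hP : P * P = P) (hE : E * P = P * E) :
    (1 - P + P * x * P) * ((1 - P) + E * P) * (1 - P + P * y * P) + P * x * (E * (1 - P)) * y * P
     = (1 - P) + P * x * E * y * P := by
  have hP' : ∀ z, P * (P * z) = P * z := fun z => by rw [← mul_assoc, hP]
  have hE' : ∀ z, E * (P * z) = P * (E * z) := fun z => by rw [← mul_assoc, hE, mul_assoc]
  simp only [mul_add, add_mul, sub_mul, mul_sub, mul_assoc, hP, hP', hE, hE', mul_one, one_mul]
  abel

theorem det_limit {L : Type*} [NormedField L] {n : ℕ}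
    (B B' P : Matrix (Fin n) (Fin n) L) (hB : B' * B = 1) (s : L) (hs : s ≠ 0)
    (hP : P * P = P) (hBP : B * P = P * B)
    (h1 : Tendsto (fun m => (s⁻¹ • B) ^ m * (1 - P)) atTop (𝓝 0))
    (h2 : Tendsto (fun m => (s • B') ^ m * P) atTop (𝓝 0)) (x y : Matrix (Fin n) (Fin n) L) :
    Tendsto (fun m : ℕ => ((1 - P + P * B * P).det ^ m)⁻¹ * (1 - P + P * (x * B ^ m * y) * P).det)
      atTop (𝓝 ((1 - P + P * x * P).det * (1 - P + P * y * P).det)) := by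
  have hBB' : B * B' = 1 := mul_eq_one_comm.1 hB
  have hB'P : B' * P = P * B' := by
    calc B' * P = B' * P * (B * B') := by rw [hBB', mul_one]
      _ = B' * (P * B) * B' := by simp only [mul_assoc]
      _ = P * B' := by rw [← hBP, ← mul_assoc, hB, one_mul]
  have hc1 : ∀ m, (s⁻¹ • B) ^ m * P = P * (s⁻¹ • B) ^ m := fun m =>
    ((show Commute B P from hBP).smul_left s⁻¹).pow_left m
  have hc2 : ∀ m, (s • B') ^ m * P = P * (s • B') ^ m := fun m =>
    ((show Commute B' P from hB'P).smul_left s).pow_left m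
  have hP0 : (1 - P) * P = 0 := by rw [sub_mul, one_mul, hP, sub_self]
  have hP0' : P * (1 - P) = 0 := by rw [mul_sub, mul_one, hP, sub_self]
  have hPI : (1 - P) * (1 - P) = 1 - P := by rw [mul_sub, hP0, mul_one, sub_zero]
  have hinv : ∀ m, (s • B') ^ m * (s⁻¹ • B) ^ m = 1 := by
    intro m
    have hcomm : Commute (s • B') (s⁻¹ • B) :=
      ((show Commute B' B from hB.trans hBB'.symm).smul_left s).smul_right s⁻¹
    rw [← hcomm.mul_pow, smul_mul_smul_comm, mul_inv_cancel₀ hs, hB, one_smul, one_pow]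
  -- multiplication rule
  have hmulrule : ∀ C C' : Matrix (Fin n) (Fin n) L, C' * P = P * C' →
      ((1 - P) + C * P) * ((1 - P) + C' * P) = (1 - P) + C * C' * P := by
    intro C C' hC
    have e1 : (1 - P) * (C' * P) = 0 := by rw [hC, ← mul_assoc, hP0, zero_mul]
    have e2 : C * P * (1 - P) = 0 := by rw [mul_assoc, hP0', mul_zero]
    have e3 : C * P * (C' * P) = C * C' * P := by
      rw [mul_assoc, ← mul_assoc P, ← hC, mul_assoc, hP, mul_assoc]
    rw [add_mul, mul_add, mul_add, hPI, e1, e2, e3, add_zero, zero_add]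
  let a1 : ℕ → Matrix (Fin n) (Fin n) L := fun m => (1 - P) + (s⁻¹ • B) ^ m * P
  let b1 : ℕ → Matrix (Fin n) (Fin n) L := fun m => (1 - P) + (s • B') ^ m * P
  let D : ℕ → Matrix (Fin n) (Fin n) L := fun m => (1 - P) + (s ^ m • (1 : Matrix (Fin n) (Fin n) L)) * P
  let T : ℕ → Matrix (Fin n) (Fin n) L := fun m => P * x * ((s⁻¹ • B) ^ m * (1 - P)) * y * P
  have hba : ∀ m, b1 m * a1 m = 1 := by
    intro m
    simp only [a1, b1]
    rw [hmulrule _ _ (hc1 m), hinv, one_mul, sub_add_cancel]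
  have hab : ∀ m, a1 m * b1 m = 1 := fun m => mul_eq_one_comm.1 (hba m)
  have hpow : ∀ m, (1 - P + P * B * P) ^ m = (1 - P) + B ^ m * P := by
    intro m
    have e0 : 1 - P + P * B * P = (1 - P) + B * P := by rw [← hBP, mul_assoc, hP]
    rw [e0]
    induction m with
    | zero => simp
    | succ m ih => rw [pow_succ, ih, hmulrule _ _ hBP, pow_succ]
  have hsB : ∀ m, (s ^ m • (1 : Matrix (Fin n) (Fin n) L)) * (s⁻¹ • B) ^ m = B ^ m := by
    intro m
    rw [smul_pow, smul_mul_assoc, one_mul, smul_smul, ← mul_pow, mul_inv_cancel₀ hs, one_pow,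
      one_smul]
  have hDa : ∀ m, (1 - P + P * B * P) ^ m = D m * a1 m := by
    intro m
    simp only [a1, D]
    rw [hmulrule _ _ (hc1 m), hpow, hsB]
  have hDX : ∀ m, 1 - P + P * (x * B ^ m * y) * P =
      D m * ((1 - P + P * x * P) * a1 m * (1 - P + P * y * P) + T m) := by
    intro m
    simp only [a1, T]
    rw [ring_id1 P ((s⁻¹ • B) ^ m) x y hP (hc1 m)]
    have e1 : D m * (1 - P) = 1 - P := by
      simp only [D]
      rw [add_mul, mul_assoc, hP0', mul_zero, add_zero, hPI]
    have e2 : D m * P = s ^ m • P := by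
      simp only [D]
      rw [add_mul, mul_assoc, hP0, hP, zero_add, smul_mul_assoc, one_mul]
    rw [mul_add, e1]
    simp only [← mul_assoc]
    rw [e2, ← hsB m]
    simp only [smul_mul_assoc, mul_smul_comm, mul_assoc, one_mul]
  have hdetD : ∀ m, (D m).det ≠ 0 := by
    intro m
    have : D m * ((1 - P) + ((s ^ m)⁻¹ • (1 : Matrix (Fin n) (Fin n) L)) * P) = 1 := by
      simp only [D]
      rw [hmulrule _ _ (by simp), smul_mul_smul_comm, mul_inv_cancel₀ (pow_ne_zero _ hs), one_smul,
        one_mul, one_mul, sub_add_cancel]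
    intro h0
    have := congrArg det this
    rw [det_mul, h0, zero_mul, det_one] at this
    exact zero_ne_one this
  have hdetab : ∀ m, (b1 m).det * (a1 m).det = 1 := fun m => by rw [← det_mul, hba, det_one]
  have heq : ∀ m, ((1 - P + P * B * P).det ^ m)⁻¹ * (1 - P + P * (x * B ^ m * y) * P).det =
      (fromBlocks (b1 m) (-(1 - P + P * y * P)) (1 - P + P * x * P) (T m)).det := by
    intro m
    let _ : Invertible (b1 m) := ⟨a1 m, hab m, hba m⟩
    have hi : ⅟(b1 m) = a1 m := rfl
    rw [det_fromBlocks₁₁, hi, ← det_pow, hDa, hDX, det_mul, det_mul, mul_neg, sub_neg_eq_add,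
      add_comm (T m)]
    have ha0 : (a1 m).det ≠ 0 := right_ne_zero_of_mul_eq_one (hdetab m)
    have hb1 : (b1 m).det = (a1 m).det⁻¹ := eq_inv_of_mul_eq_one_left (hdetab m)
    rw [hb1]
    field_simp [hdetD m]
  have hb1lim : Tendsto b1 atTop (𝓝 (1 - P)) := by
    simpa using h2.const_add (1 - P)
  have hTlim : Tendsto T atTop (𝓝 0) := by
    have := ((h1.const_mul (P * x)).mul_const y).mul_const P
    simpa using this
  have hcont : Continuous fun p : Matrix (Fin n) (Fin n) L × Matrix (Fin n) (Fin n) L =>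
      (fromBlocks p.1 (-(1 - P + P * y * P)) (1 - P + P * x * P) p.2).det := by
    apply Continuous.matrix_det
    exact Continuous.matrix_fromBlocks continuous_fst continuous_const continuous_const continuous_snd
  have hfin := (hcont.tendsto (1 - P, 0)).comp (hb1lim.prodMk_nhds hTlim)
  simp only [det_block_swap] at hfin
  refine hfin.congr fun m => ?_
  rw [heq]; rfl

theorem exists_c {G L : Type*} [Group G] [NormedField L] [IsAlgClosed L] {n : ℕ}
    (M : G →* Matrix (Fin n) (Fin n) L) (g : G)
    (hev : ∃ a, (M g).charpoly.IsRoot a ∧ 1 < ‖a‖) :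
    ∃ (c : G → L) (Λ : L), c ∈ regAlg M ∧ c 1 = 1 ∧ c g ≠ 1 ∧
      ∀ x y, Tendsto (fun m : ℕ => (Λ ^ m)⁻¹ * c (x * g ^ m * y)) atTop (𝓝 (c x * c y)) := by
  have hB : M g⁻¹ * M g = 1 := by rw [← map_mul, inv_mul_cancel, map_one]
  obtain ⟨P, s, hs, hP, hBP, hP0, h1, h2, h3⟩ := exists_proj (M g) (M g⁻¹) hB hev
  refine ⟨fun x => (1 - P + P * M x * P).det, (1 - P + P * M g * P).det, ?_, ?_, ?_, ?_⟩
  · refine RegM.det ?_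
    exact (RegM.const (1 - P)).add (((RegM.const P).mul RegM.id).mul (RegM.const P))
  · simp [hP]
  · intro hdet
    change (1 - P + P * M g * P).det = 1 at hdet
    have hPP : (1 - P) * P = 0 := by rw [sub_mul, one_mul, hP, sub_self]
    have hpow : ∀ m : ℕ, ((1 - P) + M g⁻¹ ^ m * P) * (1 - P + P * M g * P) ^ m = 1 := by
      intro m
      have hc : Commute (M g) P := hBP
      have e0 : 1 - P + P * M g * P = (1 - P) + M g * P := by rw [← hBP, mul_assoc, hP]
      have hP0' : P * (1 - P) = 0 := by rw [mul_sub, mul_one, hP, sub_self]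
      have hPI : (1 - P) * (1 - P) = 1 - P := by rw [mul_sub, hPP, mul_one, sub_zero]
      have hmulrule : ∀ C C' : Matrix (Fin n) (Fin n) L, C' * P = P * C' →
          ((1 - P) + C * P) * ((1 - P) + C' * P) = (1 - P) + C * C' * P := by
        intro C C' hC
        have e1 : (1 - P) * (C' * P) = 0 := by rw [hC, ← mul_assoc, hPP, zero_mul]
        have e2 : C * P * (1 - P) = 0 := by rw [mul_assoc, hP0', mul_zero]
        have e3 : C * P * (C' * P) = C * C' * P := by
          rw [mul_assoc, ← mul_assoc P, ← hC, mul_assoc, hP, mul_assoc]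
        rw [add_mul, mul_add, mul_add, hPI, e1, e2, e3, add_zero, zero_add]
      have e4 : (1 - P + P * M g * P) ^ m = (1 - P) + M g ^ m * P := by
        rw [e0]
        induction m with
        | zero => simp
        | succ m ih => rw [pow_succ, ih, hmulrule _ _ hBP, pow_succ]
      rw [e4, hmulrule _ _ (hc.pow_left m), ← map_pow, ← map_pow, ← map_mul, inv_pow, inv_mul_cancel, map_one,
        one_mul, sub_add_cancel]
    have hlim : Tendsto (fun m : ℕ => ((1 - P) + M g⁻¹ ^ m * P).det) atTop (𝓝 (1 - P).det) := by
      have e5 := h3.const_add (1 - P)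
      rw [add_zero] at e5
      exact ((Continuous.matrix_det continuous_id).tendsto (1 - P)).comp e5
    have hone : ∀ m : ℕ, ((1 - P) + M g⁻¹ ^ m * P).det = 1 := by
      intro m
      have := congrArg det (hpow m)
      rwa [det_mul, det_pow, hdet, one_pow, mul_one, det_one] at this
    simp only [hone] at hlim
    have hd1 : (1 - P).det = 1 := (tendsto_nhds_unique hlim tendsto_const_nhds)
    have hu : IsUnit (1 - P) := by
      rw [Matrix.isUnit_iff_isUnit_det, hd1]; exact isUnit_one
    exact hP0 (hu.mul_right_eq_zero.1 hPP)
  · intro x y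
    have := det_limit (M g) (M g⁻¹) P hB s hs hP hBP h1 h2 (M x) (M y)
    simpa only [← map_pow, ← map_mul] using this

theorem free_of_eigenvalue {G L : Type*} [Group G] [NormedField L] [IsAlgClosed L] {n : ℕ}
    (hcomp : ∀ s : Set L, s.Finite → ∃ F : Subfield L, s ⊆ F ∧
      IsCompact ((F : Set L) ∩ Metric.closedBall 0 1))
    (M : G →* Matrix (Fin n) (Fin n) L) (hM : Conn M) (g : G) (hg : g ∈ commutator G)
    (hev : ∃ a, (M g).charpoly.IsRoot a ∧ 1 < ‖a‖) :
    ∃ f : FreeGroup (Fin 2) →* G, Function.Injective f := by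
  obtain ⟨c, Λ, hc, hc1, hcg, hlim⟩ := exists_c M g hev
  refine free_of_c hcomp hM c hc hc1 g Λ hlim ?_
  by_contra! h
  apply hcg
  let χ : G →* L := { toFun := c, map_one' := hc1, map_mul' := h }
  have : commutator G ≤ χ.toHomUnits.ker := Abelianization.commutator_subset_ker _
  have h2 : χ.toHomUnits g = 1 := this hg
  exact congrArg Units.val h2
open Cardinal in
theorem exists_ext {R K L : Type*} [CommRing R] [IsDomain R] [Field K] [Field L] [Algebra R K] [Algebra R L]
    [FaithfulSMul R K] [FaithfulSMul R L] [IsAlgClosed L] [Countable K] [Uncountable L] :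
    Nonempty (K →ₐ[R] L) := by
  have hR : Countable R := (FaithfulSMul.algebraMap_injective R K).countable
  obtain ⟨s, hs⟩ := exists_isTranscendenceBasis R K
  obtain ⟨t, ht⟩ := exists_isTranscendenceBasis R L
  have hcard := IsAlgClosed.cardinal_le_max_transcendence_basis _ ht
  have htu : Uncountable t := by
    by_contra h
    rw [not_uncountable_iff] at h
    have h3 : ℵ₀ < #L := Cardinal.aleph0_lt_mk
    have := hcard.trans (max_le (max_le (by simp) (by simp)) le_rfl)
    have h4 : #L ≤ ℵ₀ := by simpa using this
    exact absurd h3 (not_lt.2 h4)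
  have : Infinite t := inferInstance
  have : ∃ e : s → t, Function.Injective e := by
    obtain ⟨f, hf⟩ := exists_injective_nat s
    exact ⟨fun x => Infinite.natEmbedding t (f x), (Infinite.natEmbedding t).injective.comp hf⟩
  obtain ⟨e, he⟩ := this
  have hw : AlgebraicIndependent R (fun x : s => ((e x : t) : L)) := ht.1.comp e he
  let a1 : Algebra (MvPolynomial s R) K := (MvPolynomial.aeval (R := R) ((↑) : s → K)).toRingHom.toAlgebra
  let a2 : Algebra (MvPolynomial s R) L := (MvPolynomial.aeval (R := R) (fun x : s => ((e x : t) : L))).toRingHom.toAlgebra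
  have : IsScalarTower R (MvPolynomial s R) K := IsScalarTower.of_algebraMap_eq' (by
    ext; simp [RingHom.algebraMap_toAlgebra])
  have : IsScalarTower R (MvPolynomial s R) L := IsScalarTower.of_algebraMap_eq' (by
    ext; simp [RingHom.algebraMap_toAlgebra])
  have : FaithfulSMul (MvPolynomial s R) K := (faithfulSMul_iff_algebraMap_injective _ _).2 hs.1
  have : FaithfulSMul (MvPolynomial s R) L := (faithfulSMul_iff_algebraMap_injective _ _).2 hw
  have : Algebra.IsAlgebraic (MvPolynomial s R) K := by
    have h0 : Algebra.IsAlgebraic (Algebra.adjoin R (Set.range ((↑) : s → K))) K := hs.isAlgebraic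
    refine Algebra.IsAlgebraic.of_ringHom_of_comp_eq (S := Algebra.adjoin R (Set.range ((↑) : s → K)))
      (B := K) hs.1.aevalEquiv (RingHom.id K) hs.1.aevalEquiv.surjective Function.injective_id ?_
    ext x
    · simp [RingHom.algebraMap_toAlgebra]
    · simp [RingHom.algebraMap_toAlgebra]
  exact ⟨(IsAlgClosed.lift : K →ₐ[MvPolynomial s R] L).restrictScalars R⟩

theorem exists_hom_root {K L : Type*} [Field K] [CharZero K] [Countable K] [Field L] [CharZero L]
    [IsAlgClosed L] [Uncountable L] (a : K) (ha : IsIntegral ℚ a) (z : L)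
    (hz : Polynomial.aeval z (minpoly ℚ a) = 0) : ∃ φ : K →+* L, φ a = z := by
  classical
  let e := IntermediateField.algHomAdjoinIntegralEquiv ℚ (K := L) ha
  let f : IntermediateField.adjoin ℚ {a} →ₐ[ℚ] L := e.symm ⟨z, by
    rw [Polynomial.mem_aroots]; exact ⟨minpoly.ne_zero ha, hz⟩⟩
  have hf : f (IntermediateField.AdjoinSimple.gen ℚ a) = z :=
    IntermediateField.algHomAdjoinIntegralEquiv_symm_apply_gen ℚ ha _
  let := f.toRingHom.toAlgebra
  have : FaithfulSMul (IntermediateField.adjoin ℚ {a}) L :=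
    (faithfulSMul_iff_algebraMap_injective _ _).2 f.toRingHom.injective
  obtain ⟨φ⟩ := exists_ext (R := IntermediateField.adjoin ℚ {a}) (K := K) (L := L)
  refine ⟨φ.toRingHom, ?_⟩
  have := φ.commutes (IntermediateField.AdjoinSimple.gen ℚ a)
  rw [← hf]
  exact this

theorem exists_hom_transc {K L : Type*} [Field K] [CharZero K] [Countable K] [Field L] [CharZero L]
    [IsAlgClosed L] [Uncountable L] (a : K) (ha : Transcendental ℚ a) (z : L)
    (hz : Transcendental ℚ z) : ∃ φ : K →+* L, φ a = z := by
  let a1 : Algebra (Polynomial ℚ) K := (Polynomial.aeval (R := ℚ) a).toRingHom.toAlgebra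
  let a2 : Algebra (Polynomial ℚ) L := (Polynomial.aeval (R := ℚ) z).toRingHom.toAlgebra
  have : FaithfulSMul (Polynomial ℚ) K := (faithfulSMul_iff_algebraMap_injective _ _).2
    (transcendental_iff_injective.1 ha)
  have : FaithfulSMul (Polynomial ℚ) L := (faithfulSMul_iff_algebraMap_injective _ _).2
    (transcendental_iff_injective.1 hz)
  obtain ⟨φ⟩ := exists_ext (R := Polynomial ℚ) (K := K) (L := L)
  refine ⟨φ.toRingHom, ?_⟩
  have := φ.commutes Polynomial.X
  simpa [RingHom.algebraMap_toAlgebra] using this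

theorem exists_transc_large (C : ℝ) : ∃ z : ℂ, Transcendental ℚ z ∧ C < ‖z‖ := by
  have h1 : {x : ℂ | IsAlgebraic ℚ x}.Countable := Algebraic.countable ℚ ℂ
  obtain ⟨z, hz⟩ : ∃ z : ℂ, z ∉ {x : ℂ | IsAlgebraic ℚ x} := by
    by_contra! h
    have : {x : ℂ | IsAlgebraic ℚ x} = Set.univ := Set.eq_univ_of_forall h
    rw [this] at h1
    exact not_countable_complex h1
  have hz0 : z ≠ 0 := by
    rintro rfl
    exact hz isAlgebraic_zero
  obtain ⟨m, hm⟩ := exists_nat_gt (max C 0 / ‖z‖)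
  have hzp : 0 < ‖z‖ := norm_pos_iff.2 hz0
  rw [div_lt_iff₀ hzp] at hm
  have hm0 : m ≠ 0 := by
    rintro rfl
    have := le_max_right C 0
    simp at hm
  refine ⟨m * z, fun h => hz ?_, ?_⟩
  · have h2 : IsAlgebraic ℚ ((m : ℂ)⁻¹) := by
      have := isAlgebraic_algebraMap (R := ℚ) (A := ℂ) ((m : ℚ)⁻¹)
      simpa using this
    have := h2.mul h
    rwa [← mul_assoc, inv_mul_cancel₀ (by exact_mod_cast hm0), one_mul] at this
  · rw [norm_mul, Complex.norm_natCast]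
    exact (le_max_left C 0).trans_lt hm

theorem exists_padic_of_not_int (q : ℚ) (hq : q.den ≠ 1) :
    ∃ (p : ℕ) (_ : Fact p.Prime), 1 < ‖(q : ℚ_[p])‖ := by
  have hp : Fact (q.den.minFac).Prime := ⟨Nat.minFac_prime hq⟩
  refine ⟨q.den.minFac, hp, ?_⟩
  by_contra! h
  have h1 : ‖((q.den : ℤ) : ℚ_[q.den.minFac])‖ < 1 :=
    (Padic.norm_intCast_lt_one_iff).2 (by exact_mod_cast Nat.minFac_dvd _)
  have h2 : (q.num : ℚ_[q.den.minFac]) = q * ((q.den : ℤ) : ℚ_[q.den.minFac]) := by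
    have := Rat.mul_den_eq_num q
    have h3 : ((q.num : ℚ) : ℚ_[q.den.minFac]) = ((q * q.den : ℚ) : ℚ_[q.den.minFac]) := by rw [this]
    rw [Rat.cast_mul, Rat.cast_intCast, Rat.cast_natCast] at h3
    rw [h3, Int.cast_natCast]
  have h3 : ‖(q.num : ℚ_[q.den.minFac])‖ < 1 := by
    rw [h2, norm_mul]
    calc _ ≤ 1 * ‖((q.den : ℤ) : ℚ_[q.den.minFac])‖ := by gcongr
      _ < 1 := by rwa [one_mul]
  have h4 := (Padic.norm_intCast_lt_one_iff).1 h3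
  have h5 : q.den.minFac ∣ q.num.natAbs := Int.natCast_dvd.1 h4
  have h6 := Nat.dvd_gcd h5 (Nat.minFac_dvd q.den)
  rw [q.reduced.gcd_eq_one] at h6
  exact (Nat.minFac_prime hq).one_lt.ne' (Nat.dvd_one.1 h6)

theorem coeff_le_one_of_roots {L : Type*} [NormedField L] [IsUltrametricDist L] (p : Polynomial L)
    (hm : p.Monic) (hs : p.Splits) (hr : ∀ r ∈ p.roots, ‖r‖ ≤ 1) (i : ℕ) : ‖p.coeff i‖ ≤ 1 := by
  let A : Subring L :=
    { carrier := {x | ‖x‖ ≤ 1}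
      mul_mem' := fun {a b} ha hb => by
        change ‖a * b‖ ≤ 1
        rw [norm_mul]
        exact mul_le_one₀ ha (norm_nonneg _) hb
      one_mem' := by simp
      add_mem' := fun {a b} ha hb => (IsUltrametricDist.norm_add_le_max a b).trans (max_le ha hb)
      zero_mem' := by simp
      neg_mem' := fun {a} ha => by simpa using ha }
  have h : p ∈ Polynomial.lifts A.subtype := by
    rw [hs.eq_prod_roots_of_monic hm]
    refine multiset_prod_mem _ fun q hq => ?_
    obtain ⟨r, hr', rfl⟩ := Multiset.mem_map.1 hq
    exact ⟨Polynomial.X - Polynomial.C ⟨r, hr r hr'⟩, by simp⟩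
  have := (Polynomial.lifts_iff_coeff_lifts p).1 h i
  obtain ⟨x, hx⟩ := this
  rw [← hx]; exact x.2

theorem hcomp_complex (s : Set ℂ) (_ : s.Finite) :
    ∃ F : Subfield ℂ, s ⊆ F ∧ IsCompact ((F : Set ℂ) ∩ Metric.closedBall 0 1) :=
  ⟨⊤, fun _ _ => trivial, by
    simpa using isCompact_closedBall (0 : ℂ) 1⟩

theorem hcomp_padic (p : ℕ) [Fact p.Prime] (s : Set (PadicAlgCl p)) (hs : s.Finite) :
    ∃ F : Subfield (PadicAlgCl p), s ⊆ F ∧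
      IsCompact ((F : Set (PadicAlgCl p)) ∩ Metric.closedBall 0 1) := by
  let E := IntermediateField.adjoin ℚ_[p] s
  have := hs.to_subtype
  have hfin : FiniteDimensional ℚ_[p] E :=
    IntermediateField.finiteDimensional_adjoin
      (fun x _ => (Algebra.IsAlgebraic.isAlgebraic x).isIntegral)
  have hfin' : FiniteDimensional ℚ_[p] E.toSubmodule := hfin
  have hp : ProperSpace E.toSubmodule := FiniteDimensional.proper ℚ_[p] E.toSubmodule
  refine ⟨E.toSubfield, IntermediateField.subset_adjoin _ _, ?_⟩
  have h := (isCompact_closedBall (0 : E.toSubmodule) 1).image continuous_subtype_val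
  convert h using 1
  ext x
  constructor
  · rintro ⟨h1, h2⟩
    exact ⟨⟨x, h1⟩, by simpa using h2, rfl⟩
  · rintro ⟨y, h1, rfl⟩
    exact ⟨y.2, by simpa using h1⟩

theorem uncountable_padic (p : ℕ) [Fact p.Prime] : Uncountable (PadicAlgCl p) := by
  have h := continuum_le_cardinal_of_nontriviallyNormedField ℚ_[p]
  have : Uncountable ℚ_[p] := by
    rw [← Cardinal.aleph0_lt_mk_iff]
    exact Cardinal.aleph0_lt_continuum.trans_le h
  exact (algebraMap ℚ_[p] (PadicAlgCl p)).injective.uncountable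

theorem uncountable_complex : Uncountable ℂ := by
  rw [← Cardinal.aleph0_lt_mk_iff, Cardinal.mk_complex]
  exact Cardinal.aleph0_lt_continuum

theorem exists_hom_padic {K : Type*} [Field K] [CharZero K] [Countable K] (a : K)
    (ha : IsIntegral ℚ a) (hna : ¬ IsIntegral ℤ a) :
    ∃ (p : ℕ) (_ : Fact p.Prime) (φ : K →+* PadicAlgCl p), 1 < ‖φ a‖ := by
  obtain ⟨i, hi⟩ : ∃ i, ((minpoly ℚ a).coeff i).den ≠ 1 := by
    by_contra! h
    apply hna
    have hl : minpoly ℚ a ∈ Polynomial.lifts (Int.castRingHom ℚ) := by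
      rw [Polynomial.lifts_iff_coeff_lifts]
      intro i
      exact ⟨((minpoly ℚ a).coeff i).num, by simpa using Rat.coe_int_num_of_den_eq_one (h i)⟩
    obtain ⟨q, hq, -, hqm⟩ := Polynomial.lifts_and_degree_eq_and_monic hl (minpoly.monic ha)
    refine ⟨q, hqm, ?_⟩
    have h1 := minpoly.aeval ℚ a
    rw [← hq, Polynomial.aeval_def, Polynomial.eval₂_map] at h1
    have e : algebraMap ℤ K = (algebraMap ℚ K).comp (Int.castRingHom ℚ) := RingHom.ext_int _ _
    rw [e]
    exact h1
  obtain ⟨p, hp, h1⟩ := exists_padic_of_not_int _ hi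
  have := uncountable_padic p
  obtain ⟨z, hz, hz1⟩ : ∃ z : PadicAlgCl p, Polynomial.aeval z (minpoly ℚ a) = 0 ∧ 1 < ‖z‖ := by
    by_contra! h
    have h2 := coeff_le_one_of_roots ((minpoly ℚ a).map (algebraMap ℚ (PadicAlgCl p)))
      ((minpoly.monic ha).map _) (IsAlgClosed.splits _) (fun r hr => h r (by
        have := (Polynomial.mem_roots'.1 hr).2
        rwa [Polynomial.IsRoot.def, Polynomial.eval_map_algebraMap] at this)) i
    rw [Polynomial.coeff_map] at h2
    have h3 : algebraMap ℚ (PadicAlgCl p) ((minpoly ℚ a).coeff i) =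
        algebraMap ℚ_[p] (PadicAlgCl p) (((minpoly ℚ a).coeff i : ℚ) : ℚ_[p]) := by
      simp
    rw [h3, PadicAlgCl.norm_extends] at h2
    exact absurd h1 (not_lt.2 h2)
  obtain ⟨φ, hφ⟩ := exists_hom_root a ha z hz
  exact ⟨p, hp, φ, by rwa [hφ]⟩

/-- Bounded algebraic integers. -/
def Good {K : Type*} [Field K] [CharZero K] (C : ℝ) (a : K) : Prop :=
  IsIntegral ℤ a ∧ ∀ z : ℂ, Polynomial.aeval z (minpoly ℚ a) = 0 → ‖z‖ ≤ C

theorem exists_hom_of_not_good {K : Type*} [Field K] [CharZero K] [Countable K] (C : ℝ) (a : K)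
    (h : ¬ Good C a) : (∃ φ : K →+* ℂ, C < ‖φ a‖) ∨
    ∃ (p : ℕ) (_ : Fact p.Prime) (φ : K →+* PadicAlgCl p), 1 < ‖φ a‖ := by
  have := uncountable_complex
  by_cases hq : IsIntegral ℚ a
  · by_cases hz : IsIntegral ℤ a
    · left
      have : ∃ z : ℂ, Polynomial.aeval z (minpoly ℚ a) = 0 ∧ C < ‖z‖ := by
        by_contra! h'
        exact h ⟨hz, h'⟩
      obtain ⟨z, h1, h2⟩ := this
      obtain ⟨φ, hφ⟩ := exists_hom_root a hq z h1
      exact ⟨φ, by rwa [hφ]⟩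
    · right
      exact exists_hom_padic a hq hz
  · left
    obtain ⟨z, h1, h2⟩ := exists_transc_large C
    obtain ⟨φ, hφ⟩ := exists_hom_transc a (fun h => hq h.isIntegral) z h1
    exact ⟨φ, by rwa [hφ]⟩

theorem free_of_not_good {G K : Type*} [Group G] [Field K] [CharZero K] [Countable K] {n : ℕ}
    (ρ : G →* Matrix (Fin n) (Fin n) K) (hc : Conn ρ) (g : G) (hg : g ∈ commutator G) (i : ℕ)
    (h : ¬ Good ((max 1 1) ^ n * n.choose (n / 2)) ((ρ g).charpoly.coeff i)) :
    ∃ f : FreeGroup (Fin 2) →* G, Function.Injective f := by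
  rcases exists_hom_of_not_good _ _ h with ⟨φ, hφ⟩ | ⟨p, hp, φ, hφ⟩
  · refine free_of_eigenvalue hcomp_complex _ (hc.baseChange φ) g hg ?_
    have e : ((φ.mapMatrix.toMonoidHom.comp ρ) g).charpoly = (ρ g).charpoly.map φ :=
      Matrix.charpoly_map _ _
    rw [e]
    by_contra! h'
    have := Polynomial.coeff_bdd_of_roots_le (B := 1) (d := n) φ (Matrix.charpoly_monic (ρ g))
      (IsAlgClosed.splits _) (by rw [Matrix.charpoly_natDegree_eq_dim]; simp)
      (fun z hz => h' z (Polynomial.mem_roots'.1 hz).2) i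
    rw [Polynomial.coeff_map] at this
    exact absurd hφ (not_lt.2 this)
  · refine free_of_eigenvalue (hcomp_padic p) _ (hc.baseChange φ) g hg ?_
    have e : ((φ.mapMatrix.toMonoidHom.comp ρ) g).charpoly = (ρ g).charpoly.map φ :=
      Matrix.charpoly_map _ _
    rw [e]
    by_contra! h'
    have := coeff_le_one_of_roots ((ρ g).charpoly.map φ) ((Matrix.charpoly_monic (ρ g)).map _)
      (IsAlgClosed.splits _) (fun z hz => h' z (Polynomial.mem_roots'.1 hz).2) i
    rw [Polynomial.coeff_map] at this
    exact absurd hφ (not_lt.2 this)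

universe u_nf in
theorem exists_nf (R : Type u_nf) [CommRing R] [Nontrivial R] [Algebra ℚ R]
    [Algebra.FiniteType ℚ R] : ∃ (F : Type u_nf) (_ : Field F) (_ : NumberField F)
      (_ : R →+* F), True := by
  obtain ⟨m, hm⟩ := Ideal.exists_maximal R
  let i1 : Algebra ℚ (R ⧸ m) := Ideal.Quotient.algebra ℚ
  have hft : Algebra.FiniteType ℚ (R ⧸ m) :=
    Algebra.FiniteType.of_surjective (Ideal.Quotient.mkₐ ℚ m) (Ideal.Quotient.mkₐ_surjective ℚ m)
  let i2 : Field (R ⧸ m) := Ideal.Quotient.field m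
  have hfin : Module.Finite ℚ (R ⧸ m) := finite_of_finite_type_of_isJacobsonRing ℚ (R ⧸ m)
  have hcz : CharZero (R ⧸ m) := algebraRat.charZero _
  have hnf : NumberField (R ⧸ m) :=
    { to_charZero := hcz
      to_finiteDimensional := by
        have e : (DivisionRing.toRatAlgebra : Algebra ℚ (R ⧸ m)) = i1 := Subsingleton.elim _ _
        rw [e]
        exact hfin }
  exact ⟨R ⧸ m, i2, hnf, Ideal.Quotient.mk m, trivial⟩

theorem finite_good {K : Type*} [Field K] [CharZero K] (R : Subalgebra ℚ K) (hR : R.FG) (C : ℝ) :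
    {a : K | a ∈ R ∧ Good C a}.Finite := by
  have hft : Algebra.FiniteType ℚ R := R.fg_iff_finiteType.1 hR
  obtain ⟨F, iF, hnf, π, -⟩ := exists_nf R
  have hS := NumberField.Embeddings.finite_of_norm_le F ℂ C
  have hT : {a : R | Good C (a : K)}.Finite := by
    refine Set.Finite.of_finite_image (f := π) (hS.subset ?_) ?_
    · rintro _ ⟨a, ha, rfl⟩
      have h1 : IsIntegral ℤ a := by
        have := ha.1
        rwa [← isIntegral_algebraMap_iff (R := ℤ) (A := R) (B := K) Subtype.val_injective]
      refine ⟨h1.map π.toIntAlgHom, fun φ => ha.2 _ ?_⟩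
      have h2 : Polynomial.aeval a (minpoly ℚ (a : K)) = 0 := by
        apply Subtype.val_injective
        have := minpoly.aeval ℚ (a : K)
        have h := Polynomial.aeval_algHom_apply R.val a (minpoly ℚ (a : K))
        exact h.symm.trans this
      have h3 := congrArg ((φ.comp π).toRatAlgHom) h2
      rw [← Polynomial.aeval_algHom_apply, map_zero] at h3
      exact h3
    · intro a ha b hb hab
      by_contra hne
      have hd : ((a - b : R) : K) ≠ 0 := by
        intro h
        exact hne (sub_eq_zero.1 (Subtype.val_injective h))
      have hi : IsIntegral ℚ ((a - b : R) : K) := by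
        have h1 : IsIntegral ℤ ((a - b : R) : K) := by
          have := ha.1.sub hb.1
          simpa using this
        exact h1.tower_top
      have hinv : ((a - b : R) : K)⁻¹ ∈ R := R.inv_mem_of_algebraic hi.isAlgebraic
      have h1 : (a - b) * ⟨_, hinv⟩ = 1 := by
        apply Subtype.val_injective
        simpa using mul_inv_cancel₀ hd
      have h2 := congrArg π h1
      rw [map_mul, map_sub, hab, sub_self, zero_mul, map_one] at h2
      exact zero_ne_one h2
  refine (hT.image Subtype.val).subset ?_
  rintro a ⟨h1, h2⟩
  exact ⟨⟨a, h1⟩, h2, rfl⟩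

theorem tits_main (k : Type*) [Field k] [CharZero k]
    (n : ℕ) (Γ : Subgroup (GL (Fin n) k)) (hΓ : Γ.FG) :
    (∃ f : FreeGroup (Fin 2) →* Γ, Function.Injective f) ∨
    (∃ H : Subgroup Γ, H.FiniteIndex ∧ Group.IsSolvable H) := by
  obtain ⟨T, hT⟩ := hΓ
  let S : Set k := (⋃ t ∈ (T : Set (GL (Fin n) k)), Set.range (fun ij : Fin n × Fin n => (t : Matrix (Fin n) (Fin n) k) ij.1 ij.2)) ∪
    (⋃ t ∈ (T : Set (GL (Fin n) k)), Set.range (fun ij : Fin n × Fin n => ((t⁻¹ : GL (Fin n) k) : Matrix (Fin n) (Fin n) k) ij.1 ij.2))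
  have hSfin : S.Finite :=
    (T.finite_toSet.biUnion fun t _ => Set.finite_range _).union
      (T.finite_toSet.biUnion fun t _ => Set.finite_range _)
  let R : Subalgebra ℚ k := Algebra.adjoin ℚ S
  have hR : R.FG := Subalgebra.fg_def.2 ⟨S, hSfin, rfl⟩
  let K : Subfield k := Subfield.closure S
  have hKc : Countable K := by
    have := hSfin.countable.to_subtype
    have h := Subfield.cardinalMk_closure_le_max S
    rw [← Cardinal.mk_le_aleph0_iff]
    exact h.trans (max_le Cardinal.mk_le_aleph0 le_rfl)
  have hRK : ∀ x ∈ R, x ∈ K := by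
    intro x hx
    induction hx using Algebra.adjoin_induction with
    | mem x hx => exact Subfield.subset_closure hx
    | algebraMap r => simp
    | add x y _ _ hx hy => exact add_mem hx hy
    | mul x y _ _ hx hy => exact mul_mem hx hy
  have hent : ∀ x ∈ Γ, (∀ i j, (x : Matrix (Fin n) (Fin n) k) i j ∈ R) ∧
      (∀ i j, ((x⁻¹ : GL (Fin n) k) : Matrix (Fin n) (Fin n) k) i j ∈ R) := by
    intro x hx
    rw [← hT] at hx
    induction hx using Subgroup.closure_induction with
    | mem t ht =>
      refine ⟨fun i j => Algebra.subset_adjoin (Or.inl ?_),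
        fun i j => Algebra.subset_adjoin (Or.inr ?_)⟩
      · exact Set.mem_biUnion ht ⟨(i, j), rfl⟩
      · exact Set.mem_biUnion ht ⟨(i, j), rfl⟩
    | one =>
      have : ∀ i j, (1 : Matrix (Fin n) (Fin n) k) i j ∈ R := by
        intro i j
        rw [Matrix.one_apply]
        split_ifs
        · exact one_mem _
        · exact zero_mem _
      refine ⟨?_, ?_⟩
      · simpa using this
      · simpa using this
    | mul x y _ _ hx hy =>
      refine ⟨fun i j => ?_, fun i j => ?_⟩
      · rw [Units.val_mul, Matrix.mul_apply]
        exact sum_mem fun l _ => mul_mem (hx.1 _ _) (hy.1 _ _)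
      · rw [_root_.mul_inv_rev, Units.val_mul, Matrix.mul_apply]
        exact sum_mem fun l _ => mul_mem (hy.2 _ _) (hx.2 _ _)
    | inv x _ hx => exact ⟨hx.2, by rw [inv_inv]; exact hx.1⟩
  let ρ : Γ →* Matrix (Fin n) (Fin n) K :=
    { toFun := fun x => Matrix.of fun i j =>
        (⟨(x : GL (Fin n) k).1 i j, hRK _ ((hent x x.2).1 i j)⟩ : K)
      map_one' := by
        ext i j
        simp [Matrix.one_apply]
        split_ifs <;> simp
      map_mul' := fun x y => by
        ext i j
        simp [Matrix.mul_apply] }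
  have hρv : ∀ x i j, ((ρ x i j : K) : k) = (x : GL (Fin n) k).1 i j := fun x i j => rfl
  have hρ : Function.Injective ρ := by
    intro x y hxy
    apply Subtype.ext
    apply Units.ext
    ext i j
    rw [← hρv, ← hρv, hxy]
  have hcoef : ∀ x i, (((ρ x).charpoly.coeff i : K) : k) ∈ R := by
    intro x i
    let A : Matrix (Fin n) (Fin n) R := Matrix.of fun i j => ⟨(x : GL (Fin n) k).1 i j, (hent x x.2).1 i j⟩
    have h1 : (ρ x).map K.subtype = A.map R.val.toRingHom := by
      ext i j
      rfl
    have h2 := congrArg (fun p => Polynomial.coeff p i) (Matrix.charpoly_map (ρ x) K.subtype)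
    have h3 := congrArg (fun p => Polynomial.coeff p i) (Matrix.charpoly_map A R.val.toRingHom)
    simp only [Polynomial.coeff_map] at h2 h3
    rw [h1] at h2
    have h4 := h2.symm.trans h3
    change K.subtype _ ∈ R
    rw [h4]
    exact (A.charpoly.coeff i).2
  obtain ⟨H, hH, hconn⟩ := exists_conn ρ
  let C : ℝ := (max 1 1) ^ n * n.choose (n / 2)
  let F : Set K := {a | (a : k) ∈ R ∧ Good C a}
  have hF : F.Finite := by
    refine ((finite_good R hR C).preimage (f := K.subtype) Subtype.val_injective.injOn).subset ?_
    rintro a ⟨h1, h2, h3⟩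
    refine ⟨h1, ?_, ?_⟩
    · exact h2.map K.subtype.toIntAlgHom
    · have : minpoly ℚ (K.subtype a) = minpoly ℚ a :=
        minpoly.algebraMap_eq (A := ℚ) (B := K) (B' := k) Subtype.val_injective a
      rw [this]
      exact h3
  by_cases hall : ∀ x ∈ commutator H, ∀ i, ((ρ.comp H.subtype) x).charpoly.coeff i ∈ F
  · right
    exact ⟨H, hH, solv_of_finite (ρ.comp H.subtype) (hρ.comp Subtype.val_injective) hconn F hF hall⟩
  · left
    push Not at hall
    obtain ⟨x, hx, i, hi⟩ := hall
    have hng : ¬ Good C (((ρ.comp H.subtype) x).charpoly.coeff i) := fun h => hi ⟨hcoef _ _, h⟩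
    obtain ⟨f, hf⟩ := free_of_not_good (ρ.comp H.subtype) hconn x hx i hng
    exact ⟨H.subtype.comp f, Subtype.val_injective.comp hf⟩

/-- **Tits alternative for linear groups.** A finitely generated subgroup of
`GL_n(k)`, `k` a field of characteristic zero, either contains a nonabelian free
subgroup (a copy of the free group on two generators) or contains a solvable
subgroup of finite index. -/
theorem tits_alternative_linear (k : Type*) [Field k] [CharZero k]
    (n : ℕ) (hn : 0 < n) (Γ : Subgroup (GL (Fin n) k)) (hΓ : Γ.FG) :
    (∃ f : FreeGroup (Fin 2) →* Γ, Function.Injective f) ∨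
    (∃ H : Subgroup Γ, H.FiniteIndex ∧ IsSolvable H) := by
  exact tits_main k n Γ hΓ
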